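/- arXiv:2411.04916 — 4 statements merged into one kernel-verified Lean document; each statement's English description precedes it below -/
import Mathlib

section
/- There exists a finite set of 5730 unit vectors in the Euclidean space ℝ^17 such that the inner product of any two distinct vectors in the set is at most 1/2. (Equivalently, the kissing number in 17 dimensions is at least 5730.) -/
open scoped RealInnerProductSpace

namespace Kissing17

/-! Coordinates: a vector is `(x, √2 y)` with `x ∈ ℤ¹⁶`, `y ∈ ℤ`, and squared norm
`∑ xᵢ² + 2 y² = 288`. -/

/-- The signed indicator vector of the block listed by `P`. -/
def spread {n : ℕ} (P : Fin n → Fin 16) (σ : Fin n → ℤˣ) (i : Fin 16) : ℤ :=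
  ∑ j, if P j = i then (σ j : ℤ) else 0

/-- Size of the intersection of two blocks. -/
def meet {n m : ℕ} (P : Fin n → Fin 16) (R : Fin m → Fin 16) : ℤ :=
  ∑ j, ∑ k, if R k = P j then 1 else 0

lemma dot_spread {n : ℕ} (P : Fin n → Fin 16) (σ : Fin n → ℤˣ) (y : Fin 16 → ℤ) :
    ∑ i, spread P σ i * y i = ∑ j, (σ j : ℤ) * y (P j) := by
  simp only [spread, Finset.sum_mul]
  rw [Finset.sum_comm]
  refine Finset.sum_congr rfl fun j _ => ?_
  simp [ite_mul]

lemma spread_apply {n : ℕ} (P : Fin n → Fin 16) (hP : Function.Injective P) (σ : Fin n → ℤˣ)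
    (j : Fin n) : spread P σ (P j) = σ j := by
  simp [spread, hP.eq_iff]

lemma unit_le (u : ℤˣ) : (u : ℤ) ≤ 1 := by
  rcases Int.units_eq_one_or u with h | h <;> simp [h]

lemma dot_same {n : ℕ} (P : Fin n → Fin 16) (hP : Function.Injective P) (σ τ : Fin n → ℤˣ) :
    ∑ i, spread P σ i * spread P τ i = ∑ j, ((σ j * τ j : ℤˣ) : ℤ) := by
  rw [dot_spread]
  simp [spread_apply P hP]

lemma dot_le_meet {n m : ℕ} (P : Fin n → Fin 16) (R : Fin m → Fin 16)
    (σ : Fin n → ℤˣ) (τ : Fin m → ℤˣ) :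
    ∑ i, spread P σ i * spread R τ i ≤ meet P R := by
  rw [dot_spread]
  refine Finset.sum_le_sum fun j _ => ?_
  rw [spread, Finset.mul_sum]
  refine Finset.sum_le_sum fun k _ => ?_
  split_ifs
  · exact_mod_cast unit_le (σ j * τ k)
  · simp

lemma sum_units_le {n : ℕ} (σ : Fin n → ℤˣ) : ∑ j, (σ j : ℤ) ≤ n := by
  calc ∑ j, (σ j : ℤ) ≤ ∑ _j : Fin n, (1 : ℤ) := Finset.sum_le_sum fun j _ => unit_le _
    _ = n := by simp

lemma sum_units_ne {n : ℕ} (σ : Fin n → ℤˣ) (h : σ ≠ 1) : ∑ j, (σ j : ℤ) ≤ n - 2 := by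
  obtain ⟨a, ha⟩ := Function.ne_iff.1 h
  have ha' : σ a = -1 := (Int.units_eq_one_or _).resolve_left ha
  have h1 : ∑ j, (σ j : ℤ) ≤ ∑ j : Fin n, (if j = a then (-1 : ℤ) else 1) := by
    refine Finset.sum_le_sum fun j _ => ?_
    split_ifs with hj
    · subst hj; simp [ha']
    · exact unit_le _
  have h2 : ∀ j : Fin n, (if j = a then (-1 : ℤ) else 1) = 1 - (if j = a then 2 else 0) := by
    intro j; split_ifs <;> norm_num
  simp only [h2, Finset.sum_sub_distrib] at h1
  simpa using h1

lemma sum_units_neg {n : ℕ} (σ : Fin n → ℤˣ) (h : ∏ j, σ j = -1) :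
    ∑ j, (σ j : ℤ) ≤ n - 2 := by
  apply sum_units_ne
  rintro rfl
  rw [show ∏ j : Fin n, (1 : Fin n → ℤˣ) j = 1 by simp] at h
  exact absurd h (by decide)

lemma sum_units_pos {n : ℕ} (σ : Fin n → ℤˣ) (h : ∏ j, σ j = 1) (hne : σ ≠ 1) :
    ∑ j, (σ j : ℤ) ≤ n - 4 := by
  obtain ⟨a, ha⟩ := Function.ne_iff.1 hne
  have ha' : σ a = -1 := (Int.units_eq_one_or _).resolve_left ha
  have hne' : Function.update σ a 1 ≠ 1 := by
    intro h0
    have : ∏ j, Function.update σ a 1 j = 1 := by rw [h0]; simp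
    rw [Finset.prod_update_of_mem (Finset.mem_univ a)] at this
    rw [← Finset.mul_prod_erase _ _ (Finset.mem_univ a), ha'] at h
    rw [Finset.sdiff_singleton_eq_erase, one_mul] at this
    rw [this] at h
    exact absurd h (by decide)
  have h1 := sum_units_ne _ hne'
  have h2 : ∑ j, ((Function.update σ a 1 j : ℤˣ) : ℤ) = ∑ j, (σ j : ℤ) + 2 := by
    rw [← Finset.add_sum_erase _ _ (Finset.mem_univ a),
      ← Finset.add_sum_erase _ (fun j => (σ j : ℤ)) (Finset.mem_univ a)]
    have : ∑ j ∈ Finset.univ.erase a, ((Function.update σ a 1 j : ℤˣ) : ℤ)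
        = ∑ j ∈ Finset.univ.erase a, (σ j : ℤ) :=
      Finset.sum_congr rfl fun j hj => by rw [Function.update_of_ne (Finset.ne_of_mem_erase hj)]
    rw [this]
    simp [ha']
    ring
  linarith

/-- Extend a sign vector by one sign so that the number of minus signs is odd. -/
def oddExt {n : ℕ} (τ : Fin n → ℤˣ) : Fin (n + 1) → ℤˣ := Fin.cons (-∏ j, τ j) τ

lemma prod_oddExt {n : ℕ} (τ : Fin n → ℤˣ) : ∏ j, oddExt τ j = -1 := by
  rw [oddExt, Fin.prod_cons, neg_mul, Int.units_mul_self]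

lemma oddExt_inj {n : ℕ} {τ τ' : Fin n → ℤˣ} (h : oddExt τ = oddExt τ') : τ = τ' :=
  (Fin.cons_injective2 h).2

lemma mul_ne_one_of_ne {n : ℕ} {σ τ : Fin n → ℤˣ} (h : σ ≠ τ) :
    (fun j => σ j * τ j) ≠ 1 := by
  intro h0
  apply h
  funext j
  have := congrFun h0 j
  simp only [Pi.one_apply] at this
  rw [mul_eq_one_iff_eq_inv, Int.units_inv_eq_self] at this
  exact this

lemma odd_odd {n : ℕ} {σ τ : Fin n → ℤˣ} (hσ : ∏ j, σ j = -1) (hτ : ∏ j, τ j = -1)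
    (h : σ ≠ τ) : ∑ j, ((σ j * τ j : ℤˣ) : ℤ) ≤ n - 4 :=
  sum_units_pos (fun j => σ j * τ j) (by rw [Finset.prod_mul_distrib, hσ, hτ]; decide)
    (mul_ne_one_of_ne h)

/-- The 30 octads (weight 8 words of the first order Reed-Muller code). -/
def oct : Fin 30 → Fin 8 → Fin 16 :=
  ![![1, 3, 5, 7, 9, 11, 13, 15],
    ![0, 2, 4, 6, 8, 10, 12, 14],
    ![2, 3, 6, 7, 10, 11, 14, 15],
    ![0, 1, 4, 5, 8, 9, 12, 13],
    ![1, 2, 5, 6, 9, 10, 13, 14],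
    ![0, 3, 4, 7, 8, 11, 12, 15],
    ![4, 5, 6, 7, 12, 13, 14, 15],
    ![0, 1, 2, 3, 8, 9, 10, 11],
    ![1, 3, 4, 6, 9, 11, 12, 14],
    ![0, 2, 5, 7, 8, 10, 13, 15],
    ![2, 3, 4, 5, 10, 11, 12, 13],
    ![0, 1, 6, 7, 8, 9, 14, 15],
    ![1, 2, 4, 7, 9, 10, 12, 15],
    ![0, 3, 5, 6, 8, 11, 13, 14],
    ![8, 9, 10, 11, 12, 13, 14, 15],
    ![0, 1, 2, 3, 4, 5, 6, 7],
    ![1, 3, 5, 7, 8, 10, 12, 14],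
    ![0, 2, 4, 6, 9, 11, 13, 15],
    ![2, 3, 6, 7, 8, 9, 12, 13],
    ![0, 1, 4, 5, 10, 11, 14, 15],
    ![1, 2, 5, 6, 8, 11, 12, 15],
    ![0, 3, 4, 7, 9, 10, 13, 14],
    ![4, 5, 6, 7, 8, 9, 10, 11],
    ![0, 1, 2, 3, 12, 13, 14, 15],
    ![1, 3, 4, 6, 8, 10, 13, 15],
    ![0, 2, 5, 7, 9, 11, 12, 14],
    ![2, 3, 4, 5, 8, 9, 14, 15],
    ![0, 1, 6, 7, 10, 11, 12, 13],
    ![1, 2, 4, 7, 8, 11, 13, 14],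
    ![0, 3, 5, 6, 9, 10, 12, 15]]

/-- The 16 hexads (a biplane). -/
def hexad : Fin 16 → Fin 6 → Fin 16 :=
  ![![3, 7, 11, 12, 13, 14],
    ![1, 5, 9, 12, 14, 15],
    ![2, 6, 10, 12, 13, 15],
    ![0, 4, 8, 13, 14, 15],
    ![3, 4, 5, 6, 11, 15],
    ![1, 4, 6, 7, 9, 13],
    ![2, 4, 5, 7, 10, 14],
    ![0, 5, 6, 7, 8, 12],
    ![3, 7, 8, 9, 10, 15],
    ![1, 5, 8, 10, 11, 13],
    ![2, 6, 8, 9, 11, 14],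
    ![0, 4, 9, 10, 11, 12],
    ![0, 1, 2, 7, 11, 15],
    ![0, 2, 3, 5, 9, 13],
    ![0, 1, 3, 6, 10, 14],
    ![1, 2, 3, 4, 8, 12]]

/-- Coset representatives of the first order Reed-Muller code; the first six are used in the
upper layer, the last six in the lower layer. -/
def rep : Fin 12 → ℕ := ![0, 27328, 50848, 29224, 47176, 7816, 30856, 4680, 48680, 2720, 49344, 26112]

/-- The first order Reed-Muller code. -/
def rm : Fin 32 → ℕ := ![0, 65535, 43690, 21845, 52428, 13107, 26214, 39321, 61680, 3855, 23130, 42405, 15420, 50115, 38550, 26985, 65280, 255, 21930, 43605, 13260, 52275, 39270, 26265, 4080, 61455, 42330, 23205, 49980, 15555, 27030, 38505]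

/-- Sign vector of a bit mask. -/
def sgn (n : ℕ) (i : Fin 16) : ℤˣ := if n.testBit i then -1 else 1

lemma sgn_xor (n m : ℕ) (i : Fin 16) : sgn (n ^^^ m) i = sgn n i * sgn m i := by
  simp only [sgn, Nat.testBit_xor]
  cases n.testBit i <;> cases m.testBit i <;> simp

/-- Number of ones among the lowest sixteen binary digits. -/
def pc (n : ℕ) : ℕ :=
  n % 2 + n / 2 % 2 + n / 4 % 2 + n / 8 % 2 + n / 16 % 2 + n / 32 % 2 + n / 64 % 2 +
  n / 128 % 2 + n / 256 % 2 + n / 512 % 2 + n / 1024 % 2 + n / 2048 % 2 + n / 4096 % 2 +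
  n / 8192 % 2 + n / 16384 % 2 + n / 32768 % 2

/-- Digit `i` of `n`. -/
def dig (n : ℕ) (i : Fin 16) : ℕ := n / 2 ^ (i : ℕ) % 2

lemma sum_dig (n : ℕ) : ∑ i, dig n i = pc n := by
  simp [dig, pc, Fin.sum_univ_succ]
  ring

lemma dig_and (n m : ℕ) (i : Fin 16) : dig (n &&& m) i = dig n i * dig m i := by
  simp only [dig, ← Nat.toNat_testBit, Nat.testBit_and]
  cases n.testBit i <;> cases m.testBit i <;> simp

lemma sgn_eq_pow (n : ℕ) (i : Fin 16) : sgn n i = (-1) ^ dig n i := by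
  simp only [sgn, dig, ← Nat.toNat_testBit]
  cases n.testBit i <;> simp

lemma sgn_eq_sub (n : ℕ) (i : Fin 16) : (sgn n i : ℤ) = 1 - 2 * (dig n i : ℤ) := by
  simp only [sgn, dig, ← Nat.toNat_testBit]
  cases n.testBit i <;> simp

lemma sum_sgn (n : ℕ) : ∑ i, (sgn n i : ℤ) = 16 - 2 * (pc n : ℤ) := by
  simp only [sgn_eq_sub, Finset.sum_sub_distrib, ← Finset.mul_sum, ← sum_dig]
  simp

/-- The mask `a` describes the block `P`. -/
def Desc {n : ℕ} (P : Fin n → Fin 16) (a : ℕ) : Prop :=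
  ∀ i, (∑ j, if P j = i then 1 else 0) = dig a i

lemma sum_desc {n : ℕ} {P : Fin n → Fin 16} {a : ℕ} (h : Desc P a) (f : Fin 16 → ℕ) :
    ∑ j, f (P j) = ∑ i, dig a i * f i := by
  simp only [← h _, Finset.sum_mul]
  rw [Finset.sum_comm]
  refine Finset.sum_congr rfl fun j _ => ?_
  simp [ite_mul]

lemma meet_desc {n m : ℕ} {P : Fin n → Fin 16} {R : Fin m → Fin 16} {a b : ℕ}
    (hP : Desc P a) (hR : Desc R b) : meet P R = (pc (a &&& b) : ℕ) := by
  rw [← sum_dig]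
  simp only [dig_and]
  rw [← sum_desc hP, meet]
  push_cast
  refine Finset.sum_congr rfl fun j _ => ?_
  rw [← hR]
  push_cast
  rfl

lemma prod_desc {n : ℕ} {P : Fin n → Fin 16} {a : ℕ} (hP : Desc P a) (c : ℕ)
    (h : pc (a &&& c) % 2 = 0) : ∏ j, sgn c (P j) = 1 := by
  simp only [sgn_eq_pow]
  rw [Finset.prod_pow_eq_pow_sum, sum_desc hP (fun i => dig c i)]
  simp only [← dig_and]
  rw [sum_dig]
  exact Even.neg_one_pow (Nat.even_iff.2 h)

/-- Masks of the octads. -/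
def om : Fin 30 → ℕ := ![43690, 21845, 52428, 13107, 26214, 39321, 61680, 3855, 23130, 42405, 15420, 50115, 38550, 26985, 65280, 255, 21930, 43605, 13260, 52275, 39270, 26265, 4080, 61455, 42330, 23205, 49980, 15555, 27030, 38505]

/-- Masks of the hexads. -/
def hm : Fin 16 → ℕ := ![30856, 53794, 46148, 57617, 34936, 8914, 17588, 4577, 34696, 11554, 19268, 7697, 34951, 8749, 17483, 4382]

lemma oct_desc : ∀ k, Desc (oct k) (om k) := by unfold Desc; decide +kernel
lemma hexad_desc : ∀ k, Desc (hexad k) (hm k) := by unfold Desc; decide +kernel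
lemma om_om : ∀ k l, k ≠ l → pc (om k &&& om l) ≤ 4 := by decide +kernel
lemma om_hm : ∀ k l, pc (om k &&& hm l) ≤ 4 := by decide +kernel
lemma hm_hm : ∀ k l, k ≠ l → pc (hm k &&& hm l) ≤ 2 := by decide +kernel
lemma om_rep : ∀ k s, pc (om k &&& rep s) % 2 = 0 := by decide +kernel
lemma om_rm : ∀ k s, pc (om k &&& rm s) % 2 = 0 := by decide +kernel
lemma hm_rep : ∀ k s, pc (hm k &&& rep s) % 2 = 0 := by decide +kernel
lemma hm_rm : ∀ k s, pc (hm k &&& rm s) % 2 = 0 := by decide +kernel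

lemma oct_inj : ∀ k, Function.Injective (oct k) := by decide +kernel
lemma hexad_inj : ∀ k, Function.Injective (hexad k) := by decide +kernel

lemma oct_oct (k l : Fin 30) (h : k ≠ l) : meet (oct k) (oct l) ≤ 4 := by
  rw [meet_desc (oct_desc k) (oct_desc l)]
  exact_mod_cast om_om k l h

lemma oct_hexad (k : Fin 30) (l : Fin 16) : meet (oct k) (hexad l) ≤ 4 := by
  rw [meet_desc (oct_desc k) (hexad_desc l)]
  exact_mod_cast om_hm k l

lemma hexad_hexad (k l : Fin 16) (h : k ≠ l) : meet (hexad k) (hexad l) ≤ 2 := by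
  rw [meet_desc (hexad_desc k) (hexad_desc l)]
  exact_mod_cast hm_hm k l h

lemma oct_rep (k : Fin 30) (s : Fin 12) : ∏ j, sgn (rep s) (oct k j) = 1 :=
  prod_desc (oct_desc k) _ (om_rep k s)

lemma oct_rm (k : Fin 30) (s : Fin 32) : ∏ j, sgn (rm s) (oct k j) = 1 :=
  prod_desc (oct_desc k) _ (om_rm k s)

lemma hexad_rep (k : Fin 16) (s : Fin 12) : ∏ j, sgn (rep s) (hexad k j) = 1 :=
  prod_desc (hexad_desc k) _ (hm_rep k s)

lemma hexad_rm (k : Fin 16) (s : Fin 32) : ∏ j, sgn (rm s) (hexad k j) = 1 :=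
  prod_desc (hexad_desc k) _ (hm_rm k s)

lemma rm_xor : ∀ a b : Fin 32, rm a ^^^ rm b = rm (a ^^^ b) ∧ (a ^^^ b = 0 → a = b) := by
  decide +kernel

lemma rm_add (a b : Fin 32) : ∃ c, rm a ^^^ rm b = rm c ∧ (c = 0 → a = b) :=
  ⟨a ^^^ b, rm_xor a b⟩

/-- The layer of a coset representative. -/
def lay (s : Fin 12) : ℤ := if s < 6 then 1 else -1

lemma code_wt : ∀ s t l, (s = t → l ≠ 0) →
    (if (s < 6) = (t < 6) then 6 else 4) ≤ pc (rep s ^^^ rep t ^^^ rm l) := by decide +kernel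

lemma code_dist (s t : Fin 12) (l : Fin 32) (h : s = t → l ≠ 0) :
    ∑ i, (sgn (rep s ^^^ rep t ^^^ rm l) i : ℤ) ≤ 6 - 2 * (lay s * lay t) := by
  have := code_wt s t l h
  rw [sum_sgn]
  unfold lay
  by_cases h1 : s < 6 <;> by_cases h2 : t < 6 <;> simp [h1, h2] at this ⊢ <;> omega

/-- Index type of the pairs. -/
abbrev Pr := {p : Fin 16 × Fin 16 // p.1 < p.2}

def pr (p : Pr) : Fin 2 → Fin 16 := ![p.1.1, p.1.2]

lemma pr_inj (p : Pr) : Function.Injective (pr p) := by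
  intro a b h
  have := p.2.ne
  fin_cases a <;> fin_cases b <;> simp_all [pr]

lemma pr_pr (p q : Pr) (h : p ≠ q) : meet (pr p) (pr q) ≤ 1 := by
  obtain ⟨⟨a, b⟩, hp⟩ := p
  obtain ⟨⟨c, d⟩, hq⟩ := q
  simp only [ne_eq, Subtype.mk.injEq, Prod.mk.injEq] at h hp hq
  simp only [meet, pr, Fin.sum_univ_two, Matrix.cons_val_zero, Matrix.cons_val_one]
  by_cases h1 : c = a <;> by_cases h2 : d = a <;> by_cases h3 : c = b <;> by_cases h4 : d = b <;>
    first | (exfalso; omega) | simp [h1, h2, h3, h4, hp.ne, hp.ne']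

lemma pr_le {n : ℕ} (p : Pr) (R : Fin n → Fin 16) (hR : Function.Injective R) :
    meet (pr p) R ≤ 2 := by
  have key : ∀ i : Fin 16, (∑ k, if R k = i then (1 : ℤ) else 0) ≤ 1 := by
    intro i
    by_cases hi : ∃ k, R k = i
    · obtain ⟨k, rfl⟩ := hi
      simp [hR.eq_iff]
    · push Not at hi
      simp [hi]
  rw [meet, Fin.sum_univ_two]
  linarith [key (pr p 0), key (pr p 1)]

/-- The index type of the configuration. -/
abbrev Idx :=
  (Pr × (Fin 2 → ℤˣ)) ⊕ (Fin 30 × (Fin 7 → ℤˣ)) ⊕ (Fin 16 × (Fin 5 → ℤˣ) × ℤˣ) ⊕ ℤˣ ⊕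
    (Fin 12 × Fin 32)

lemma card_Idx : Fintype.card Idx = 5730 := by
  have h1 : Fintype.card Pr = 120 := by decide +kernel
  simp only [Idx, Fintype.card_sum, Fintype.card_prod, Fintype.card_fun, Fintype.card_fin, h1,
    Fintype.card_units_int]
  norm_num

/-- First sixteen coordinates. -/
def X : Idx → Fin 16 → ℤ
  | .inl (p, σ) => fun i => 12 * spread (pr p) σ i
  | .inr (.inl (k, τ)) => fun i => 6 * spread (oct k) (oddExt τ) i
  | .inr (.inr (.inl (k, τ, _))) => fun i => 6 * spread (hexad k) (oddExt τ) i
  | .inr (.inr (.inr (.inl _))) => fun _ => 0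
  | .inr (.inr (.inr (.inr (s, l)))) => fun i => 4 * sgn (rep s ^^^ rm l) i

/-- Last coordinate, divided by `√2`. -/
def Y : Idx → ℤ
  | .inl _ => 0
  | .inr (.inl _) => 0
  | .inr (.inr (.inl (_, _, e))) => 6 * e
  | .inr (.inr (.inr (.inl e))) => 12 * e
  | .inr (.inr (.inr (.inr (s, _)))) => 4 * lay s

/-- The scaled inner product. -/
def ip (a b : Idx) : ℤ := ∑ i, X a i * X b i + 2 * (Y a * Y b)

lemma ip_comm (a b : Idx) : ip a b = ip b a := by
  simp only [ip, mul_comm]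

lemma pull (c d : ℤ) (f g : Fin 16 → ℤ) :
    ∑ i, c * f i * (d * g i) = c * d * ∑ i, f i * g i := by
  rw [Finset.mul_sum]
  exact Finset.sum_congr rfl fun i _ => by ring

lemma lay_sq (s : Fin 12) : lay s * lay s = 1 := by
  unfold lay; split_ifs <;> norm_num

lemma unit_sq (e : ℤˣ) : (e : ℤ) * e = 1 := by
  rcases Int.units_eq_one_or e with h | h <;> simp [h]

lemma sum_sq {n : ℕ} (σ : Fin n → ℤˣ) : ∑ j, ((σ j * σ j : ℤˣ) : ℤ) = n := by
  simp [Int.units_mul_self]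

lemma ip_self (a : Idx) : ip a a = 288 := by
  rcases a with ⟨p, σ⟩ | ⟨k, τ⟩ | ⟨k, τ, e⟩ | e | ⟨s, l⟩ <;> simp only [ip, X, Y]
  · rw [pull, dot_same _ (pr_inj p), sum_sq]; norm_num
  · rw [pull, dot_same _ (oct_inj k), sum_sq]; norm_num
  · rw [pull, dot_same _ (hexad_inj k), sum_sq]
    push_cast
    linarith [unit_sq e]
  · simp only [mul_zero, Finset.sum_const_zero]
    linarith [unit_sq e]
  · rw [pull]
    simp only [unit_sq]
    simp only [Finset.sum_const, Finset.card_univ, Fintype.card_fin]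
    linarith [lay_sq s, show (16 : ℕ) • (1 : ℤ) = 16 by norm_num]

lemma word_odd {n : ℕ} (P : Fin n → Fin 16) (σ : Fin n → ℤˣ) (a b : ℕ)
    (hσ : ∏ j, σ j = -1) (ha : ∏ j, sgn a (P j) = 1) (hb : ∏ j, sgn b (P j) = 1) :
    ∑ i, spread P σ i * (sgn (a ^^^ b) i : ℤ) ≤ n - 2 := by
  rw [dot_spread P σ (fun i => (sgn (a ^^^ b) i : ℤ))]
  have := sum_units_neg (fun j => σ j * sgn (a ^^^ b) (P j)) (by
    simp only [sgn_xor, Finset.prod_mul_distrib, hσ, ha, hb, mul_one])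
  simpa only [Units.val_mul] using this

lemma word_le {n : ℕ} (P : Fin n → Fin 16) (σ : Fin n → ℤˣ) (a : ℕ) :
    ∑ i, spread P σ i * (sgn a i : ℤ) ≤ n := by
  rw [dot_spread P σ (fun i => (sgn a i : ℤ))]
  have := sum_units_le (fun j => σ j * sgn a (P j))
  simpa only [Units.val_mul] using this

lemma unit_mul_le (e f : ℤˣ) : (e : ℤ) * f ≤ 1 := by exact_mod_cast unit_le (e * f)

lemma lay_cases (s : Fin 12) : lay s = 1 ∨ lay s = -1 := by
  unfold lay; split_ifs <;> simp

lemma ip_AA (a b : Pr × (Fin 2 → ℤˣ)) (h : a ≠ b) : ip (.inl a) (.inl b) ≤ 144 := by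
  obtain ⟨p, σ⟩ := a
  obtain ⟨q, τ⟩ := b
  simp only [ip, X, Y]
  rw [pull]
  by_cases hpq : p = q
  · subst hpq
    have hne : σ ≠ τ := fun h' => h (by rw [h'])
    have := sum_units_ne _ (mul_ne_one_of_ne hne)
    rw [dot_same _ (pr_inj p)]
    push_cast at this ⊢
    linarith
  · linarith [dot_le_meet (pr p) (pr q) σ τ, pr_pr p q hpq]

lemma ip_BB (a b : Fin 30 × (Fin 7 → ℤˣ)) (h : a ≠ b) :
    ip (.inr (.inl a)) (.inr (.inl b)) ≤ 144 := by
  obtain ⟨p, σ⟩ := a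
  obtain ⟨q, τ⟩ := b
  simp only [ip, X, Y]
  rw [pull]
  by_cases hpq : p = q
  · subst hpq
    have hne : oddExt σ ≠ oddExt τ := fun h' => h (by rw [oddExt_inj h'])
    have := odd_odd (prod_oddExt σ) (prod_oddExt τ) hne
    rw [dot_same _ (oct_inj p)]
    push_cast at this ⊢
    linarith
  · linarith [dot_le_meet (oct p) (oct q) (oddExt σ) (oddExt τ), oct_oct p q hpq]

lemma ip_CC (a b : Fin 16 × (Fin 5 → ℤˣ) × ℤˣ) (h : a ≠ b) :
    ip (.inr (.inr (.inl a))) (.inr (.inr (.inl b))) ≤ 144 := by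
  obtain ⟨p, σ, e⟩ := a
  obtain ⟨q, τ, f⟩ := b
  simp only [ip, X, Y]
  rw [pull]
  have hef := unit_mul_le e f
  by_cases hpq : p = q
  · subst hpq
    rw [dot_same _ (hexad_inj p)]
    by_cases he : e = f
    · subst he
      have hne : oddExt σ ≠ oddExt τ := fun h' => h (by rw [oddExt_inj h'])
      have := odd_odd (prod_oddExt σ) (prod_oddExt τ) hne
      push_cast at this ⊢
      linarith
    · have h1 : (e : ℤ) * f = -1 := by
        rcases Int.units_eq_one_or e with h | h <;> rcases Int.units_eq_one_or f with h' | h' <;>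
          simp_all
      have := sum_units_le (fun j => oddExt σ j * oddExt τ j)
      push_cast at this ⊢
      linarith
  · linarith [dot_le_meet (hexad p) (hexad q) (oddExt σ) (oddExt τ), hexad_hexad p q hpq]

lemma ip_EE (a b : Fin 12 × Fin 32) (h : a ≠ b) :
    ip (.inr (.inr (.inr (.inr a)))) (.inr (.inr (.inr (.inr b)))) ≤ 144 := by
  obtain ⟨s, l⟩ := a
  obtain ⟨t, m⟩ := b
  simp only [ip, X, Y]
  rw [pull]
  obtain ⟨c, hc, hc0⟩ := rm_add l m
  have hd := code_dist s t c (by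
    rintro rfl h0
    exact h (by rw [hc0 h0]))
  have heq : ∀ i, (sgn (rep s ^^^ rm l) i : ℤ) * (sgn (rep t ^^^ rm m) i : ℤ)
      = (sgn (rep s ^^^ rep t ^^^ rm c) i : ℤ) := by
    intro i
    rw [← hc]
    simp only [sgn_xor, Units.val_mul]
    ring
  simp only [heq]
  rcases lay_cases s with h1 | h1 <;> rcases lay_cases t with h2 | h2 <;>
    rw [h1, h2] at hd ⊢ <;> linarith

lemma ip_lt (a b : Idx) (h : a ≠ b) : ip a b ≤ 144 := by
  have AB : ∀ a b, ip (.inl a) (.inr (.inl b)) ≤ 144 := by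
    rintro ⟨p, σ⟩ ⟨k, τ⟩
    simp only [ip, X, Y]
    rw [pull]
    linarith [dot_le_meet (pr p) (oct k) σ (oddExt τ), pr_le p _ (oct_inj k)]
  have AC : ∀ a b, ip (.inl a) (.inr (.inr (.inl b))) ≤ 144 := by
    rintro ⟨p, σ⟩ ⟨k, τ, e⟩
    simp only [ip, X, Y]
    rw [pull]
    linarith [dot_le_meet (pr p) (hexad k) σ (oddExt τ), pr_le p _ (hexad_inj k)]
  have AD : ∀ a b, ip (.inl a) (.inr (.inr (.inr (.inl b)))) ≤ 144 := by
    rintro ⟨p, σ⟩ e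
    simp [ip, X, Y]
  have AE : ∀ a b, ip (.inl a) (.inr (.inr (.inr (.inr b)))) ≤ 144 := by
    rintro ⟨p, σ⟩ ⟨s, l⟩
    simp only [ip, X, Y]
    rw [pull]
    have := word_le (pr p) σ (rep s ^^^ rm l)
    push_cast at this
    linarith
  have BC : ∀ a b, ip (.inr (.inl a)) (.inr (.inr (.inl b))) ≤ 144 := by
    rintro ⟨p, σ⟩ ⟨k, τ, e⟩
    simp only [ip, X, Y]
    rw [pull]
    linarith [dot_le_meet (oct p) (hexad k) (oddExt σ) (oddExt τ), oct_hexad p k]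
  have BD : ∀ a b, ip (.inr (.inl a)) (.inr (.inr (.inr (.inl b)))) ≤ 144 := by
    rintro ⟨p, σ⟩ e
    simp [ip, X, Y]
  have BE : ∀ a b, ip (.inr (.inl a)) (.inr (.inr (.inr (.inr b)))) ≤ 144 := by
    rintro ⟨k, τ⟩ ⟨s, l⟩
    simp only [ip, X, Y]
    rw [pull]
    have := word_odd (oct k) _ (rep s) (rm l) (prod_oddExt τ) (oct_rep k s) (oct_rm k l)
    push_cast at this
    linarith
  have CD : ∀ a b, ip (.inr (.inr (.inl a))) (.inr (.inr (.inr (.inl b)))) ≤ 144 := by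
    rintro ⟨k, τ, e⟩ f
    simp only [ip, X, Y, mul_zero, Finset.sum_const_zero]
    linarith [unit_mul_le e f]
  have CE : ∀ a b, ip (.inr (.inr (.inl a))) (.inr (.inr (.inr (.inr b)))) ≤ 144 := by
    rintro ⟨k, τ, e⟩ ⟨s, l⟩
    simp only [ip, X, Y]
    rw [pull]
    have := word_odd (hexad k) _ (rep s) (rm l) (prod_oddExt τ) (hexad_rep k s) (hexad_rm k l)
    push_cast at this
    rcases Int.units_eq_one_or e with h1 | h1 <;> rcases lay_cases s with h2 | h2 <;>
      rw [h1, h2] <;> push_cast <;> linarith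
  have DE : ∀ a b, ip (.inr (.inr (.inr (.inl a)))) (.inr (.inr (.inr (.inr b)))) ≤ 144 := by
    rintro e ⟨s, l⟩
    simp only [ip, X, Y, zero_mul, Finset.sum_const_zero]
    rcases Int.units_eq_one_or e with h1 | h1 <;> rcases lay_cases s with h2 | h2 <;>
      rw [h1, h2] <;> norm_num
  have DD : ∀ a b, ip (.inr (.inr (.inr (.inl a)))) (.inr (.inr (.inr (.inl b)))) ≤ 144 ∨
      a = b := by
    intro e f
    simp only [ip, X, Y, mul_zero, Finset.sum_const_zero]
    rcases Int.units_eq_one_or e with h1 | h1 <;> rcases Int.units_eq_one_or f with h2 | h2 <;>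
      rw [h1, h2] <;> simp
  rcases a with a | a | a | a | a <;> rcases b with b | b | b | b | b
  · exact ip_AA a b fun h' => h (by rw [h'])
  · exact AB a b
  · exact AC a b
  · exact AD a b
  · exact AE a b
  · rw [ip_comm]; exact AB b a
  · exact ip_BB a b fun h' => h (by rw [h'])
  · exact BC a b
  · exact BD a b
  · exact BE a b
  · rw [ip_comm]; exact AC b a
  · rw [ip_comm]; exact BC b a
  · exact ip_CC a b fun h' => h (by rw [h'])
  · exact CD a b
  · exact CE a b
  · rw [ip_comm]; exact AD b a
  · rw [ip_comm]; exact BD b a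
  · rw [ip_comm]; exact CD b a
  · exact (DD a b).resolve_right fun h' => h (by rw [h'])
  · exact DE a b
  · rw [ip_comm]; exact AE b a
  · rw [ip_comm]; exact BE b a
  · rw [ip_comm]; exact CE b a
  · rw [ip_comm]; exact DE b a
  · exact ip_EE a b fun h' => h (by rw [h'])

/-- The unit vectors. -/
noncomputable def vec (a : Idx) : EuclideanSpace ℝ (Fin 17) :=
  WithLp.toLp 2 (Fin.snoc (α := fun _ => ℝ) (fun i : Fin 16 => (X a i : ℝ) / (12 * √2))
    ((Y a : ℝ) / 12))

lemma inner_vec (a b : Idx) : ⟪vec a, vec b⟫ = (ip a b : ℝ) / 288 := by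
  have h2 : (√2 : ℝ) * √2 = 2 := Real.mul_self_sqrt (by norm_num)
  have h : ∀ i : Fin 16, (X b i : ℝ) / (12 * √2) * ((X a i : ℝ) / (12 * √2))
      = (X a i : ℝ) * X b i / 288 := by
    intro i
    rw [div_mul_div_comm, show (12 * √2) * (12 * √2) = 144 * (√2 * √2) by ring, h2]
    ring
  simp only [vec, PiLp.inner_apply, Fin.sum_univ_castSucc, Fin.snoc_castSucc, Fin.snoc_last,
    RCLike.inner_apply, conj_trivial, h, ip]
  push_cast
  rw [← Finset.sum_div]
  ring

lemma exists_of_family {ι : Type} [Fintype ι] (f : ι → EuclideanSpace ℝ (Fin 17))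
    (hself : ∀ a, ⟪f a, f a⟫ = (1 : ℝ)) (hle : ∀ a b, a ≠ b → ⟪f a, f b⟫ ≤ (1 : ℝ) / 2) :
    ∃ V : Finset (EuclideanSpace ℝ (Fin 17)),
      V.card = Fintype.card ι ∧
      (∀ v ∈ V, ‖v‖ = 1) ∧
      (∀ v ∈ V, ∀ w ∈ V, v ≠ w → ⟪v, w⟫ ≤ (1 : ℝ) / 2) := by
  classical
  have hinj : Function.Injective f := by
    intro a b hab
    by_contra hne
    have h1 := hle a b hne
    rw [← hab, hself] at h1
    norm_num at h1
  refine ⟨Finset.univ.image f, ?_, ?_, ?_⟩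
  · rw [Finset.card_image_of_injective _ hinj, Finset.card_univ]
  · intro v hv
    obtain ⟨a, -, rfl⟩ := Finset.mem_image.1 hv
    have h := hself a
    rw [real_inner_self_eq_norm_sq] at h
    nlinarith [norm_nonneg (f a)]
  · intro v hv w hw hvw
    obtain ⟨a, -, rfl⟩ := Finset.mem_image.1 hv
    obtain ⟨b, -, rfl⟩ := Finset.mem_image.1 hw
    exact hle a b fun h => hvw (by rw [h])

end Kissing17

open Kissing17 in
/-- The kissing number in 17 dimensions is at least 5730: there is a set of 5730 unit
vectors in Euclidean space ℝ^17 whose pairwise inner products are at most 1/2. -/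
theorem kissing_dim17_ge_5730 :
    ∃ V : Finset (EuclideanSpace ℝ (Fin 17)),
      V.card = 5730 ∧
      (∀ v ∈ V, ‖v‖ = 1) ∧
      (∀ v ∈ V, ∀ w ∈ V, v ≠ w → ⟪v, w⟫ ≤ (1 : ℝ) / 2) := by
  have hself : ∀ a, ⟪vec a, vec a⟫ = (1 : ℝ) := by
    intro a
    rw [inner_vec, ip_self]
    norm_num
  have hle : ∀ a b, a ≠ b → ⟪vec a, vec b⟫ ≤ (1 : ℝ) / 2 := by
    intro a b hab
    rw [inner_vec]
    have : (ip a b : ℝ) ≤ 144 := by exact_mod_cast ip_lt a b hab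
    linarith
  rw [← card_Idx]
  exact exists_of_family vec hself hle
end

section
/- There exists a finite set of 7654 unit vectors in the Euclidean space ℝ^18 such that the inner product of any two distinct vectors in the set is at most 1/2. (Equivalently, the kissing number in 18 dimensions is at least 7654.) -/
open scoped RealInnerProductSpace

namespace Kiss

/-- The 30 octads of the Golay code disjoint from a fixed octad `O`, as subsets of the remaining
16 coordinates (one base 16 digit for each point). -/
def octTable : List ℕ :=
  [3130549569, 3380953888, 3416666640, 3631633168, 3685315632, 3700909089,
   3703211858, 3935790386, 3951510305, 3970463296, 3971577104, 3987309072,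
   3988149280, 3989460017, 3989543011, 4201988624, 4221072928, 4238968625,
   4239877443, 4255671346, 4256781089, 4257912400, 4257973264, 4271260432,
   4273636656, 4274545953, 4274760002, 4275668820, 4275808097, 4275860256]

/-- The 48 hexads: octads meeting `O` in exactly two of three fixed points, restricted to the
remaining 16 coordinates; 16 of them for each of the three pairs. -/
def hexTable : List ℕ :=
  [11035936, 12141072, 13276739, 13337905, 14316321, 14464864,
   15304496, 15496514, 15570513, 15579780, 16283201, 16492917,
   16602160, 16632194, 16692786, 16697872, 7750432, 13207397,
   13346625, 14177313, 14395746, 14455568, 15373632, 15435280,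
   15509554, 15578963, 16409905, 16488515, 16561440, 16623728,
   16684833, 16702564, 11040067, 12154417, 13276960, 14312464,
   14391376, 14464050, 15304258, 15443233, 15492400, 15583345,
   16265744, 16553281, 16562822, 16610898, 16693056, 16702099]

def octMask : List ℕ :=
  [3954, 4925, 7247, 8683, 11929, 13014,
   15780, 18156, 18846, 21969, 23203, 26375,
   26741, 29754, 31560, 33975, 35781, 38794,
   39160, 42332, 43566, 46689, 47379, 49755,
   52521, 53606, 56852, 58288, 60610, 61581]

def hexMask : List ℕ :=
  [1381, 2583, 5720, 6442, 9358, 14529,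
   17289, 20660, 25186, 27920, 33234, 36512,
   41017, 45828, 51276, 54275, 221, 5088,
   7314, 8502, 11844, 12811, 17969, 18755,
   21772, 26792, 33898, 35608, 38949, 42369,
   49798, 61520, 1464, 2762, 5765, 9299,
   11041, 14364, 17236, 19494, 20585, 29058,
   33039, 37426, 40256, 41188, 51345, 58888]

/-- Generators of a `[16, 8, 4]` code; the first seven generate a `[16, 7, 6]` code. -/
def genTable : List ℕ := [46689, 60610, 15780, 31560, 58288, 34272, 28896, 57312]

def oct (o : Fin 30) (k : Fin 8) : Fin 16 :=
  Fin.ofNat 16 ((octTable.getD o.val 0) >>> (4 * k.val))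

def hex (h : Fin 48) (k : Fin 6) : Fin 16 :=
  Fin.ofNat 16 ((hexTable.getD h.val 0) >>> (4 * k.val))

def gen (k : Fin 8) (t : Fin 16) : Bool := (genTable.getD k.val 0).testBit t.val

/-- Coordinates of the roots of `A₂` with respect to the form `2 a a' + 6 b b'`. -/
def ya (c : ℕ) : ℤ := if c = 0 then 2 else if c = 1 then 1 else -1

def yb (c : ℕ) : ℤ := if c = 0 then 0 else 1

/-- The octads and hexads as bit masks. -/
def octM (o : Fin 30) : ℕ := octMask.getD o.val 0

def hexM (h : Fin 48) : ℕ := hexMask.getD h.val 0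

/-- The number of points of a list of points that lie in the set with mask `M`. -/
def overlap {n : ℕ} (p : Fin n → Fin 16) (M : ℕ) : ℤ :=
  ∑ k, if M.testBit (p k).val then 1 else 0

set_option maxRecDepth 100000

theorem oct_inj : ∀ o k l, oct o k = oct o l → k = l := by decide +kernel

theorem hex_inj : ∀ o k l, hex o k = hex o l → k = l := by decide +kernel

theorem oct_mask : ∀ o k, (octM o).testBit (oct o k).val = true := by decide +kernel

theorem hex_mask : ∀ o k, (hexM o).testBit (hex o k).val = true := by decide +kernel

theorem oct_oct : ∀ o o', o ≠ o' → overlap (oct o) (octM o') ≤ 4 := by decide +kernel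

theorem oct_hex : ∀ o h, overlap (oct o) (hexM h) ≤ 4 := by decide +kernel

theorem hex_hex : ∀ h h' : Fin 48, h ≠ h' → 36 * overlap (hex h) (hexM h') +
    9 * |2 * (ya (h.val / 16) * ya (h'.val / 16)) + 6 * (yb (h.val / 16) * yb (h'.val / 16))|
      ≤ 144 := by decide +kernel

def sg (b : Bool) : ℤ := if b then -1 else 1

theorem gen_oct : ∀ g o, ∏ k, sg (gen g (oct o k)) = 1 := by decide +kernel

theorem gen_hex : ∀ g o, ∏ k, sg (gen g (hex o k)) = 1 := by decide +kernel

/-- The sign vector of a codeword. -/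
def cw (m : Fin 8 → Bool) (t : Fin 16) : ℤ := ∏ g, sg (m g && gen g t)

theorem cw_sum : ∀ m : Fin 8 → Bool, m ≠ (fun _ => false) →
    16 * ∑ t, cw m t + 32 * sg (m 7) ≤ 144 := by decide +kernel


theorem sg_pm (b : Bool) : sg b = 1 ∨ sg b = -1 := by cases b <;> simp [sg]

theorem sg_inj (b c : Bool) (h : sg b = sg c) : b = c := by
  cases b <;> cases c <;> simp_all [sg]

theorem sg_le (b : Bool) : sg b ≤ 1 := by cases b <;> simp [sg]

theorem sg_ge (b : Bool) : -1 ≤ sg b := by cases b <;> simp [sg]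

theorem pm_mul {a b : ℤ} (ha : a = 1 ∨ a = -1) (hb : b = 1 ∨ b = -1) :
    a * b = 1 ∨ a * b = -1 := by
  rcases ha with rfl | rfl <;> rcases hb with rfl | rfl <;> simp

theorem prod_pm {ι : Type*} (s : Finset ι) (e : ι → ℤ) (h : ∀ i ∈ s, e i = 1 ∨ e i = -1) :
    ∏ i ∈ s, e i = 1 ∨ ∏ i ∈ s, e i = -1 := by
  classical
  induction s using Finset.induction_on with
  | empty => simp
  | insert a s ha ih =>
    rw [Finset.prod_insert ha]
    exact pm_mul (h a (by simp)) (ih fun i hi => h i (by simp [hi]))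

theorem sum_le_card {ι : Type*} (s : Finset ι) (e : ι → ℤ)
    (h : ∀ i ∈ s, e i = 1 ∨ e i = -1) : ∑ i ∈ s, e i ≤ s.card := by
  have := Finset.sum_le_card_nsmul s e 1 (fun i hi => by rcases h i hi with h | h <;> simp [h])
  simpa using this

/-- Signs whose product is `-1` cannot all be `1`. -/
theorem sum_odd {ι : Type*} [DecidableEq ι] (s : Finset ι) (e : ι → ℤ)
    (h : ∀ i ∈ s, e i = 1 ∨ e i = -1) (hp : ∏ i ∈ s, e i = -1) :
    ∑ i ∈ s, e i ≤ s.card - 2 := by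
  have : ∃ i ∈ s, e i = -1 := by
    by_contra hc
    push Not at hc
    have : ∏ i ∈ s, e i = 1 := Finset.prod_eq_one fun i hi => (h i hi).resolve_right (hc i hi)
    omega
  obtain ⟨i, hi, hei⟩ := this
  have h1 := sum_le_card (s.erase i) e (fun j hj => h j (Finset.mem_of_mem_erase hj))
  rw [Finset.cast_card_erase_of_mem hi] at h1
  rw [← Finset.add_sum_erase s e hi]
  omega

/-- Signs whose product is `1`, not all of them `1`: at least two of them are `-1`. -/
theorem sum_even {ι : Type*} [DecidableEq ι] (s : Finset ι) (e : ι → ℤ)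
    (h : ∀ i ∈ s, e i = 1 ∨ e i = -1) (hp : ∏ i ∈ s, e i = 1) (hne : ∃ i ∈ s, e i ≠ 1) :
    ∑ i ∈ s, e i ≤ s.card - 4 := by
  obtain ⟨i, hi, hei⟩ := hne
  have hei := (h i hi).resolve_left hei
  rw [← Finset.mul_prod_erase s e hi, hei] at hp
  have h1 := sum_odd (s.erase i) e (fun j hj => h j (Finset.mem_of_mem_erase hj)) (by omega)
  rw [Finset.cast_card_erase_of_mem hi] at h1
  rw [← Finset.add_sum_erase s e hi]
  omega

/-- Sign vectors with an odd number of minus signs, parametrized by all but one of the signs. -/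
def od {n : ℕ} (σ : Fin n → Bool) : Fin (n + 1) → ℤ :=
  Fin.cons (-∏ i, sg (σ i)) (fun i => sg (σ i))

theorem od_pm {n : ℕ} (σ : Fin n → Bool) (k) : od σ k = 1 ∨ od σ k = -1 := by
  refine Fin.cases ?_ (fun i => ?_) k
  · have := prod_pm Finset.univ (fun i => sg (σ i)) (fun i _ => sg_pm _)
    simp only [od, Fin.cons_zero]
    omega
  · simpa [od] using sg_pm _

theorem od_prod {n : ℕ} (σ : Fin n → Bool) : ∏ k, od σ k = -1 := by
  rw [Fin.prod_univ_succ]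
  simp only [od, Fin.cons_zero, Fin.cons_succ]
  rcases prod_pm Finset.univ (fun i => sg (σ i)) (fun i _ => sg_pm _) with h | h <;> rw [h] <;> rfl

theorem od_inj {n : ℕ} {σ τ : Fin n → Bool} (h : ∀ k, od σ k = od τ k) : σ = τ := by
  funext i
  have := h i.succ
  simp only [od, Fin.cons_succ] at this
  exact sg_inj _ _ this

theorem od_mul {n : ℕ} {σ τ : Fin n → Bool} (h : σ ≠ τ) :
    ∑ k, od σ k * od τ k ≤ (n : ℤ) - 3 := by
  have := sum_even Finset.univ (fun k => od σ k * od τ k)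
    (fun i _ => pm_mul (od_pm _ _) (od_pm _ _))
    (by rw [Finset.prod_mul_distrib, od_prod, od_prod]; rfl) (by
      by_contra hc
      push Not at hc
      apply h
      apply od_inj
      intro k
      have := hc k (Finset.mem_univ k)
      rcases od_pm σ k with h1 | h1 <;> rcases od_pm τ k with h2 | h2 <;> simp_all)
  simp at this
  linarith

theorem od_mul_le {n : ℕ} (σ τ : Fin n → Bool) :
    ∑ k, od σ k * od τ k ≤ (n : ℤ) + 1 := by
  have := sum_le_card Finset.univ (fun k => od σ k * od τ k)
    (fun i _ => pm_mul (od_pm _ _) (od_pm _ _))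
  simpa using this

/-- The vector with entries `6 e k` at the points `p k`. -/
def sp {n : ℕ} (p : Fin n → Fin 16) (e : Fin n → ℤ) (t : Fin 16) : ℤ :=
  ∑ k, if p k = t then 6 * e k else 0

theorem sp_dot {n : ℕ} (p : Fin n → Fin 16) (e : Fin n → ℤ) (v : Fin 16 → ℤ) :
    ∑ t, sp p e t * v t = 6 * ∑ k, e k * v (p k) := by
  simp only [sp, Finset.sum_mul, Finset.mul_sum]
  rw [Finset.sum_comm]
  refine Finset.sum_congr rfl fun k _ => ?_
  simp [ite_mul, mul_assoc]

theorem sp_at {n : ℕ} (p : Fin n → Fin 16) (hp : ∀ k l, p k = p l → k = l) (e : Fin n → ℤ)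
    (k : Fin n) : sp p e (p k) = 6 * e k := by
  rw [sp, Finset.sum_eq_single k]
  · simp
  · intro l _ hl
    rw [if_neg]
    exact fun h => hl (hp _ _ h)
  · simp

theorem sp_abs {n : ℕ} (p : Fin n → Fin 16) (hp : ∀ k l, p k = p l → k = l) (M : ℕ)
    (hM : ∀ k, M.testBit (p k).val = true) (e : Fin n → ℤ)
    (he : ∀ k, e k = 1 ∨ e k = -1) (t : Fin 16) :
    |sp p e t| ≤ 6 * (if M.testBit t.val then 1 else 0) := by
  by_cases h : ∃ k, p k = t
  · obtain ⟨k, rfl⟩ := h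
    rw [sp_at p hp, hM k]
    rcases he k with h | h <;> simp [h]
  · push Not at h
    have : sp p e t = 0 := Finset.sum_eq_zero fun k _ => if_neg (h k)
    rw [this]
    split_ifs <;> simp

theorem sp_abs6 {n : ℕ} (p : Fin n → Fin 16) (hp : ∀ k l, p k = p l → k = l)
    (e : Fin n → ℤ) (he : ∀ k, e k = 1 ∨ e k = -1) (t : Fin 16) : |sp p e t| ≤ 6 := by
  by_cases h : ∃ k, p k = t
  · obtain ⟨k, rfl⟩ := h
    rw [sp_at p hp]
    rcases he k with h | h <;> simp [h]
  · push Not at h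
    have : sp p e t = 0 := Finset.sum_eq_zero fun k _ => if_neg (h k)
    simp [this]

theorem sp_sp_same {n : ℕ} (p : Fin n → Fin 16) (hp : ∀ k l, p k = p l → k = l)
    (e e' : Fin n → ℤ) : ∑ t, sp p e t * sp p e' t = 36 * ∑ k, e k * e' k := by
  rw [sp_dot, Finset.mul_sum, Finset.mul_sum]
  refine Finset.sum_congr rfl fun k _ => ?_
  rw [sp_at p hp]
  ring

theorem pm_mul_le {a b : ℤ} (ha : a = 1 ∨ a = -1) : a * b ≤ |b| := by
  rcases ha with rfl | rfl
  · simpa using le_abs_self b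
  · simpa using neg_le_abs b

theorem sp_sp {n m : ℕ} (p : Fin n → Fin 16) (q : Fin m → Fin 16)
    (hq : ∀ k l, q k = q l → k = l) (M : ℕ) (hM : ∀ k, M.testBit (q k).val = true)
    (e : Fin n → ℤ) (he : ∀ k, e k = 1 ∨ e k = -1)
    (e' : Fin m → ℤ) (he' : ∀ k, e' k = 1 ∨ e' k = -1) :
    ∑ t, sp p e t * sp q e' t ≤ 36 * overlap p M := by
  rw [sp_dot, overlap, Finset.mul_sum, Finset.mul_sum]
  refine Finset.sum_le_sum fun k _ => ?_
  have h1 := sp_abs q hq M hM e' he' (p k)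
  have h2 := pm_mul_le (b := sp q e' (p k)) (he k)
  linarith

theorem cw_pm (m t) : cw m t = 1 ∨ cw m t = -1 := prod_pm _ _ fun _ _ => sg_pm _

theorem cw_mul (m m' : Fin 8 → Bool) (t) :
    cw m t * cw m' t = cw (fun g => xor (m g) (m' g)) t := by
  rw [cw, cw, cw, ← Finset.prod_mul_distrib]
  refine Finset.prod_congr rfl fun g _ => ?_
  cases m g <;> cases m' g <;> cases gen g t <;> rfl

theorem cw_prod {n : ℕ} (p : Fin n → Fin 16) (hp : ∀ g, ∏ k, sg (gen g (p k)) = 1)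
    (m : Fin 8 → Bool) : ∏ k, cw m (p k) = 1 := by
  simp only [cw]
  rw [Finset.prod_comm]
  refine Finset.prod_eq_one fun g _ => ?_
  cases m g
  · simp [sg]
  · simpa using hp g

theorem sp_cw {n : ℕ} (p : Fin (n + 1) → Fin 16) (hp : ∀ g, ∏ k, sg (gen g (p k)) = 1)
    (σ : Fin n → Bool) (m : Fin 8 → Bool) :
    ∑ t, sp p (od σ) t * (4 * cw m t) ≤ 24 * ((n : ℤ) - 1) := by
  rw [sp_dot]
  have := sum_odd Finset.univ (fun k => od σ k * cw m (p k))
    (fun k _ => pm_mul (od_pm _ _) (cw_pm _ _))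
    (by rw [Finset.prod_mul_distrib, od_prod, cw_prod p hp]; rfl)
  simp at this
  have h2 : ∑ k, od σ k * (4 * cw m (p k)) = 4 * ∑ k, od σ k * cw m (p k) := by
    rw [Finset.mul_sum]
    exact Finset.sum_congr rfl fun k _ => by ring
  rw [h2]
  linarith

/-- The five kinds of vectors. -/
abbrev TA := {p : Fin 16 × Fin 16 // p.1 < p.2} × Bool × Bool
abbrev TB := Fin 30 × (Fin 7 → Bool)
abbrev TM := Fin 48 × Bool × (Fin 5 → Bool)
abbrev TR := Fin 3 × Bool
abbrev TS := Fin 8 → Bool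
abbrev Ix := TA ⊕ TB ⊕ TM ⊕ TR ⊕ TS

theorem card_TA : Fintype.card {p : Fin 16 × Fin 16 // p.1 < p.2} = 120 := by decide +kernel

theorem card_Ix : Fintype.card Ix = 7654 := by
  simp only [Ix, TA, TB, TM, TR, TS, Fintype.card_sum, Fintype.card_prod, card_TA,
    Fintype.card_fin, Fintype.card_bool, Fintype.card_fun]
  norm_num

def xA (i : TA) (t : Fin 16) : ℤ :=
  (if i.1.1.1 = t then 12 * sg i.2.1 else 0) + (if i.1.1.2 = t then 12 * sg i.2.2 else 0)

/-- The first sixteen coordinates. -/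
def X : Ix → Fin 16 → ℤ
  | .inl i => xA i
  | .inr (.inl i) => sp (oct i.1) (od i.2)
  | .inr (.inr (.inl i)) => sp (hex i.1) (od i.2.2)
  | .inr (.inr (.inr (.inl _))) => fun _ => 0
  | .inr (.inr (.inr (.inr m))) => fun t => 4 * cw m t

/-- The last two coordinates. -/
def Ya : Ix → ℤ
  | .inl _ => 0
  | .inr (.inl _) => 0
  | .inr (.inr (.inl i)) => 3 * sg i.2.1 * ya (i.1.val / 16)
  | .inr (.inr (.inr (.inl i))) => 6 * sg i.2 * ya i.1.val
  | .inr (.inr (.inr (.inr m))) => 4 * sg (m 7)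

def Yb : Ix → ℤ
  | .inl _ => 0
  | .inr (.inl _) => 0
  | .inr (.inr (.inl i)) => 3 * sg i.2.1 * yb (i.1.val / 16)
  | .inr (.inr (.inr (.inl i))) => 6 * sg i.2 * yb i.1.val
  | .inr (.inr (.inr (.inr _))) => 0

/-- The inner product, scaled by 288. -/
def Q (i j : Ix) : ℤ := ∑ t, X i t * X j t + 2 * (Ya i * Ya j) + 6 * (Yb i * Yb j)

theorem Q_comm (i j : Ix) : Q i j = Q j i := by
  simp only [Q, mul_comm]

theorem xA_dot (i : TA) (v : Fin 16 → ℤ) :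
    ∑ t, xA i t * v t = 12 * (sg i.2.1 * v i.1.1.1 + sg i.2.2 * v i.1.1.2) := by
  simp only [xA, add_mul, Finset.sum_add_distrib, ite_mul, zero_mul, Finset.sum_ite_eq,
    Finset.mem_univ, if_true]
  ring

theorem xA_le (i : TA) (v : Fin 16 → ℤ) (hv : ∀ t, |v t| ≤ 6) : ∑ t, xA i t * v t ≤ 144 := by
  rw [xA_dot]
  have h1 := pm_mul_le (b := v i.1.1.1) (sg_pm i.2.1)
  have h2 := pm_mul_le (b := v i.1.1.2) (sg_pm i.2.2)
  have := hv i.1.1.1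
  have := hv i.1.1.2
  linarith

theorem y_abs : ∀ c : ℕ, |ya c| ≤ 2 := by
  intro c
  simp only [ya]
  split_ifs <;> simp

theorem y_norm (c : ℕ) : 2 * (ya c * ya c) + 6 * (yb c * yb c) = 8 := by
  simp only [ya, yb]
  split_ifs <;> simp

theorem sg_sq (b : Bool) : sg b * sg b = 1 := by cases b <;> rfl

theorem pm_sq {a : ℤ} (h : a = 1 ∨ a = -1) : a * a = 1 := by rcases h with rfl | rfl <;> rfl

theorem Q_self (i : Ix) : Q i i = 288 := by
  rcases i with i | i | i | i | m
  · have hne : i.1.1.1 ≠ i.1.1.2 := ne_of_lt i.1.2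
    simp only [Q, X, Ya, Yb, xA_dot]
    simp only [xA, if_neg hne, if_neg hne.symm, if_true]
    linear_combination 144 * sg_sq i.2.1 + 144 * sg_sq i.2.2
  · simp only [Q, X, Ya, Yb, sp_sp_same _ (oct_inj i.1), pm_sq (od_pm _ _)]
    simp
  · simp only [Q, X, Ya, Yb, sp_sp_same _ (hex_inj i.1), pm_sq (od_pm _ _)]
    simp only [Finset.sum_const, Finset.card_univ, Fintype.card_fin]
    have h1 := sg_sq i.2.1
    have h2 := y_norm (i.1.val / 16)
    norm_num
    linear_combination 9 * h2 + 9 * (2 * (ya (i.1.val / 16) * ya (i.1.val / 16)) +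
      6 * (yb (i.1.val / 16) * yb (i.1.val / 16))) * h1
  · simp only [Q, X, Ya, Yb]
    have h1 := sg_sq i.2
    have h2 := y_norm i.1.val
    simp
    linear_combination 36 * h2 + 36 * (2 * (ya i.1.val * ya i.1.val) +
      6 * (yb i.1.val * yb i.1.val)) * h1
  · simp only [Q, X, Ya, Yb]
    have : ∀ t, 4 * cw m t * (4 * cw m t) = 16 := fun t => by
      linear_combination 16 * pm_sq (cw_pm m t)
    simp only [this]
    simp
    linear_combination 32 * sg_sq (m 7)

theorem Q_AA (i j : TA) (h : i ≠ j) : Q (.inl i) (.inl j) ≤ 144 := by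
  simp only [Q, X, Ya, Yb, xA_dot]
  obtain ⟨⟨⟨p, q⟩, hpq⟩, b, c⟩ := i
  obtain ⟨⟨⟨p', q'⟩, hpq'⟩, b', c'⟩ := j
  simp only [xA]
  simp only at hpq hpq'
  have e1 : p' = p → q' = q → ¬ (b = b' ∧ c = c') := by
    rintro rfl rfl ⟨rfl, rfl⟩
    exact h rfl
  split_ifs <;> first | (exfalso; omega) | skip
  all_goals cases b <;> cases c <;> cases b' <;> cases c' <;> simp_all [sg]

theorem Q_RR (i j : TR) (h : i ≠ j) :
    Q (.inr (.inr (.inr (.inl i)))) (.inr (.inr (.inr (.inl j)))) ≤ 144 := by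
  revert h
  revert i j
  decide +kernel

theorem Q_MR (i : TM) (j : TR) :
    Q (.inr (.inr (.inl i))) (.inr (.inr (.inr (.inl j)))) ≤ 144 := by
  simp only [Q, X, Ya, Yb]
  have key : ∀ (h : Fin 48) (b : Bool) (j : TR),
      2 * (3 * sg b * ya (h.val / 16) * (6 * sg j.2 * ya j.1.val)) +
      6 * (3 * sg b * yb (h.val / 16) * (6 * sg j.2 * yb j.1.val)) ≤ 144 := by decide +kernel
  have := key i.1 i.2.1 j
  simp only [mul_zero, Finset.sum_const_zero]
  linarith

theorem Q_MM (i j : TM) (h : i ≠ j) :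
    Q (.inr (.inr (.inl i))) (.inr (.inr (.inl j))) ≤ 144 := by
  obtain ⟨p, b, σ⟩ := i
  obtain ⟨q, c, τ⟩ := j
  simp only [Q, X, Ya, Yb]
  by_cases hpq : p = q
  · subst hpq
    rw [sp_sp_same _ (hex_inj p)]
    have h2 := y_norm (p.val / 16)
    have h3 : 2 * (3 * sg b * ya (p.val / 16) * (3 * sg c * ya (p.val / 16))) +
      6 * (3 * sg b * yb (p.val / 16) * (3 * sg c * yb (p.val / 16))) = 72 * (sg b * sg c) := by
      linear_combination 9 * (sg b * sg c) * h2
    by_cases hbc : b = c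
    · subst hbc
      have hst : σ ≠ τ := by
        rintro rfl
        exact h rfl
      have := od_mul hst
      have := sg_sq b
      push_cast at *
      linarith
    · have := od_mul_le σ τ
      have : sg b * sg c = -1 := by cases b <;> cases c <;> simp_all [sg]
      push_cast at *
      linarith
  · have h1 := sp_sp (hex p) (hex q) (hex_inj q) _ (hex_mask q) (od σ) (od_pm σ) (od τ) (od_pm τ)
    have h2 := hex_hex p q hpq
    have h3 := pm_mul_le (b := 2 * (ya (p.val / 16) * ya (q.val / 16)) +
      6 * (yb (p.val / 16) * yb (q.val / 16))) (pm_mul (sg_pm b) (sg_pm c))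
    linarith

theorem Q_S_bound (b c : Bool) (n : ℕ) : 2 * (3 * sg b * ya n * (4 * sg c)) ≤ 48 := by
  have h3 := pm_mul_le (b := ya n) (pm_mul (sg_pm b) (sg_pm c))
  have := y_abs n
  linarith

theorem Q_SS (m m' : TS) (h : m ≠ m') :
    Q (.inr (.inr (.inr (.inr m)))) (.inr (.inr (.inr (.inr m')))) ≤ 144 := by
  simp only [Q, X, Ya, Yb]
  have h1 := cw_sum (fun g => xor (m g) (m' g)) (by
    intro hc
    apply h
    funext g
    simpa using congrFun hc g)
  have h2 : ∑ t, 4 * cw m t * (4 * cw m' t) = 16 * ∑ t, cw (fun g => xor (m g) (m' g)) t := by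
    rw [Finset.mul_sum]
    refine Finset.sum_congr rfl fun t _ => ?_
    rw [← cw_mul]
    ring
  have h3 : sg (xor (m 7) (m' 7)) = sg (m 7) * sg (m' 7) := by
    cases m 7 <;> cases m' 7 <;> rfl
  rw [h2]
  simp only [h3] at h1
  linarith

theorem Q_lt (i j : Ix) (h : i ≠ j) : Q i j ≤ 144 := by
  have hAB : ∀ i j, Q (.inl i) (.inr (.inl j)) ≤ 144 := fun i j => by
    simpa [Q, X, Ya, Yb] using xA_le i _ (sp_abs6 _ (oct_inj j.1) _ (od_pm j.2))
  have hAM : ∀ i j, Q (.inl i) (.inr (.inr (.inl j))) ≤ 144 := fun i j => by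
    simpa [Q, X, Ya, Yb] using xA_le i _ (sp_abs6 _ (hex_inj j.1) _ (od_pm j.2.2))
  have hAR : ∀ i j, Q (.inl i) (.inr (.inr (.inr (.inl j)))) ≤ 144 := fun i j => by
    simp [Q, X, Ya, Yb]
  have hAS : ∀ i j, Q (.inl i) (.inr (.inr (.inr (.inr j)))) ≤ 144 := fun i j => by
    have := xA_le i (fun t => 4 * cw j t) (fun t => by
      rcases cw_pm j t with h | h <;> simp [h])
    simpa [Q, X, Ya, Yb] using this
  have hBB : ∀ i j, i ≠ j → Q (.inr (.inl i)) (.inr (.inl j)) ≤ 144 := by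
    rintro ⟨p, σ⟩ ⟨q, τ⟩ h
    simp only [Q, X, Ya, Yb]
    by_cases hpq : p = q
    · subst hpq
      rw [sp_sp_same _ (oct_inj p)]
      have hst : σ ≠ τ := by
        rintro rfl
        exact h rfl
      have := od_mul hst
      push_cast at *
      linarith
    · have h1 := sp_sp (oct p) (oct q) (oct_inj q) _ (oct_mask q) (od σ) (od_pm σ)
        (od τ) (od_pm τ)
      have h2 := oct_oct p q hpq
      linarith
  have hBM : ∀ i j, Q (.inr (.inl i)) (.inr (.inr (.inl j))) ≤ 144 := by
    rintro ⟨p, σ⟩ ⟨q, b, τ⟩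
    simp only [Q, X, Ya, Yb]
    have h1 := sp_sp (oct p) (hex q) (hex_inj q) _ (hex_mask q) (od σ) (od_pm σ) (od τ) (od_pm τ)
    have h2 := oct_hex p q
    linarith
  have hBR : ∀ i j, Q (.inr (.inl i)) (.inr (.inr (.inr (.inl j)))) ≤ 144 := fun i j => by
    simp [Q, X, Ya, Yb]
  have hBS : ∀ i j, Q (.inr (.inl i)) (.inr (.inr (.inr (.inr j)))) ≤ 144 := fun i j => by
    simp only [Q, X, Ya, Yb]
    have := sp_cw (oct i.1) (fun g => gen_oct g i.1) i.2 j
    push_cast at *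
    linarith
  have hMS : ∀ i j, Q (.inr (.inr (.inl i))) (.inr (.inr (.inr (.inr j)))) ≤ 144 :=
    fun i j => by
    simp only [Q, X, Ya, Yb]
    have h1 := sp_cw (hex i.1) (fun g => gen_hex g i.1) i.2.2 j
    have h2 := Q_S_bound i.2.1 (j 7) (i.1.val / 16)
    push_cast at *
    linarith
  have hRS : ∀ i j, Q (.inr (.inr (.inr (.inl i)))) (.inr (.inr (.inr (.inr j)))) ≤ 144 :=
    fun i j => by
    simp only [Q, X, Ya, Yb]
    have h2 := Q_S_bound i.2 (j 7) i.1.val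
    simp only [zero_mul, Finset.sum_const_zero]
    linarith
  rcases i with i | i | i | i | i <;> rcases j with j | j | j | j | j
  · exact Q_AA i j (by simpa using h)
  · exact hAB i j
  · exact hAM i j
  · exact hAR i j
  · exact hAS i j
  · rw [Q_comm]; exact hAB j i
  · exact hBB i j (by simpa using h)
  · exact hBM i j
  · exact hBR i j
  · exact hBS i j
  · rw [Q_comm]; exact hAM j i
  · rw [Q_comm]; exact hBM j i
  · exact Q_MM i j (by simpa using h)
  · exact Q_MR i j
  · exact hMS i j
  · rw [Q_comm]; exact hAR j i
  · rw [Q_comm]; exact hBR j i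
  · rw [Q_comm]; exact Q_MR j i
  · exact Q_RR i j (by simpa using h)
  · exact hRS i j
  · rw [Q_comm]; exact hAS j i
  · rw [Q_comm]; exact hBS j i
  · rw [Q_comm]; exact hMS j i
  · rw [Q_comm]; exact hRS j i
  · exact Q_SS i j (by simpa using h)

/-- The configuration. -/
noncomputable def vec (i : Ix) : EuclideanSpace ℝ (Fin 18) :=
  WithLp.toLp 2 (Fin.snoc (α := fun _ => ℝ) (Fin.snoc (α := fun _ => ℝ)
    (fun t : Fin 16 => (X i t : ℝ) / √288) ((Ya i : ℝ) / 12)) ((Yb i : ℝ) / √48))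

theorem vec_inner (i j : Ix) : ⟪vec i, vec j⟫ = (Q i j : ℝ) / 288 := by
  rw [PiLp.inner_apply, Fin.sum_univ_castSucc, Fin.sum_univ_castSucc]
  simp only [vec, Fin.snoc_castSucc, Fin.snoc_last, RCLike.inner_apply, conj_trivial, Q]
  have h1 : √(288 : ℝ) * √288 = 288 := Real.mul_self_sqrt (by norm_num)
  have h2 : √(48 : ℝ) * √48 = 48 := Real.mul_self_sqrt (by norm_num)
  simp only [div_mul_div_comm, h1, h2]
  rw [← Finset.sum_div]
  push_cast
  simp only [mul_comm]
  ring

theorem cast_le (z : ℤ) (h : z ≤ 144) : (z : ℝ) ≤ 144 := by exact_mod_cast h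

theorem finish {ι E : Type*} [Fintype ι] [NormedAddCommGroup E] [InnerProductSpace ℝ E]
    (f : ι → E) (n : ℕ) (hn : Fintype.card ι = n) (h1 : ∀ i, ⟪f i, f i⟫ = (1 : ℝ))
    (h2 : ∀ i j, i ≠ j → ⟪f i, f j⟫ ≤ (1 : ℝ) / 2) :
    ∃ V : Finset E, V.card = n ∧ (∀ v ∈ V, ‖v‖ = 1) ∧
      (∀ v ∈ V, ∀ w ∈ V, v ≠ w → ⟪v, w⟫ ≤ (1 : ℝ) / 2) := by
  classical
  have hinj : Function.Injective f := by
    intro i j hij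
    by_contra hne
    have h3 := h2 i j hne
    rw [hij, h1] at h3
    norm_num at h3
  refine ⟨Finset.univ.image f, ?_, ?_, ?_⟩
  · rw [Finset.card_image_of_injective _ hinj, Finset.card_univ, hn]
  · intro v hv
    obtain ⟨i, -, rfl⟩ := Finset.mem_image.mp hv
    have h3 := h1 i
    rw [real_inner_self_eq_norm_sq] at h3
    nlinarith [norm_nonneg (f i)]
  · intro v hv w hw hne
    obtain ⟨i, -, rfl⟩ := Finset.mem_image.mp hv
    obtain ⟨j, -, rfl⟩ := Finset.mem_image.mp hw
    exact h2 i j (fun h => hne (by rw [h]))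

end Kiss

/-- The kissing number in 18 dimensions is at least 7654: there is a set of 7654 unit
vectors in Euclidean space ℝ^18 whose pairwise inner products are at most 1/2. -/
theorem kissing_dim18_ge_7654 :
    ∃ V : Finset (EuclideanSpace ℝ (Fin 18)),
      V.card = 7654 ∧
      (∀ v ∈ V, ‖v‖ = 1) ∧
      (∀ v ∈ V, ∀ w ∈ V, v ≠ w → ⟪v, w⟫ ≤ (1 : ℝ) / 2) := by
  refine Kiss.finish Kiss.vec 7654 Kiss.card_Ix (fun i => ?_) (fun i j hne => ?_)
  · rw [Kiss.vec_inner, Kiss.Q_self]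
    norm_num
  · have h2 : (Kiss.Q i j : ℝ) ≤ 144 := Kiss.cast_le _ (Kiss.Q_lt i j hne)
    rw [Kiss.vec_inner]
    linarith
end

section
/- There exists a finite set of 11692 unit vectors in the Euclidean space ℝ^19 such that the inner product of any two distinct vectors in the set is at most 1/2. (Equivalently, the kissing number in 19 dimensions is at least 11692.) -/
open scoped RealInnerProductSpace

namespace Kissing19

/-! ### Reduction to integer vectors -/

/-- Integer dot product in dimension 19. -/
def dot (x y : Fin 19 → ℤ) : ℤ := ∑ i, x i * y i

/-- A vector of integers, scaled to the unit sphere. -/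
noncomputable def unitVec (x : Fin 19 → ℤ) : EuclideanSpace ℝ (Fin 19) :=
  WithLp.toLp 2 (fun i => (x i : ℝ) / √(dot x x : ℝ))

lemma inner_unitVec (x y : Fin 19 → ℤ) :
    ⟪unitVec x, unitVec y⟫ = (dot x y : ℝ) / (√(dot x x : ℝ) * √(dot y y : ℝ)) := by
  simp only [unitVec, PiLp.inner_apply, dot]
  push_cast
  rw [Finset.sum_div]
  refine Finset.sum_congr rfl fun i _ => ?_
  simp only [RCLike.inner_apply, conj_trivial]
  rw [div_mul_div_comm, mul_comm (y i : ℝ), mul_comm (√_) (√_)]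

lemma inner_self_unitVec (x : Fin 19 → ℤ) (h : 0 < dot x x) :
    ⟪unitVec x, unitVec x⟫ = (1 : ℝ) := by
  have h' : (0 : ℝ) < (dot x x : ℝ) := by exact_mod_cast h
  rw [inner_unitVec, Real.mul_self_sqrt h'.le, div_self h'.ne']

lemma inner_unitVec_le (x y : Fin 19 → ℤ) (hx : 0 < dot x x) (hy : 0 < dot y y) (b : ℤ)
    (hb0 : 0 ≤ b) (hb : dot x y ≤ b) (h4 : 4 * b ^ 2 ≤ dot x x * dot y y) :
    ⟪unitVec x, unitVec y⟫ ≤ (1 : ℝ) / 2 := by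
  have hx' : (0 : ℝ) < (dot x x : ℝ) := by exact_mod_cast hx
  have hy' : (0 : ℝ) < (dot y y : ℝ) := by exact_mod_cast hy
  have hb' : (dot x y : ℝ) ≤ b := by exact_mod_cast hb
  have hb0' : (0 : ℝ) ≤ b := by exact_mod_cast hb0
  have h4' : 4 * (b : ℝ) ^ 2 ≤ dot x x * dot y y := by exact_mod_cast h4
  rw [inner_unitVec, ← Real.sqrt_mul hx'.le, div_le_iff₀ (Real.sqrt_pos.2 (mul_pos hx' hy'))]
  have : 2 * (b : ℝ) ≤ √((dot x x : ℝ) * dot y y) := by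
    apply Real.le_sqrt_of_sq_le
    nlinarith
  linarith

lemma main_of_family {ι : Type} [Fintype ι] (hcard : Fintype.card ι = 11692)
    (z : ι → Fin 19 → ℤ) (hpos : ∀ i, 0 < dot (z i) (z i))
    (hz : ∀ i j, i ≠ j → ∃ b : ℤ, 0 ≤ b ∧ dot (z i) (z j) ≤ b ∧
      4 * b ^ 2 ≤ dot (z i) (z i) * dot (z j) (z j)) :
    ∃ V : Finset (EuclideanSpace ℝ (Fin 19)),
      V.card = 11692 ∧
      (∀ v ∈ V, ‖v‖ = 1) ∧
      (∀ v ∈ V, ∀ w ∈ V, v ≠ w → ⟪v, w⟫ ≤ (1 : ℝ) / 2) := by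
  classical
  have key : ∀ i j, i ≠ j → ⟪unitVec (z i), unitVec (z j)⟫ ≤ (1 : ℝ) / 2 := by
    intro i j hij
    obtain ⟨b, h0, h1, h2⟩ := hz i j hij
    exact inner_unitVec_le _ _ (hpos i) (hpos j) b h0 h1 h2
  have inj : Function.Injective fun i => unitVec (z i) := by
    intro i j hij
    by_contra hne
    have h1 := key i j hne
    have h2 := inner_self_unitVec (z i) (hpos i)
    simp only at hij
    rw [← hij, h2] at h1
    norm_num at h1
  refine ⟨Finset.univ.image fun i => unitVec (z i), ?_, ?_, ?_⟩
  · rw [Finset.card_image_of_injective _ inj, Finset.card_univ, hcard]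
  · intro v hv
    obtain ⟨i, -, rfl⟩ := Finset.mem_image.1 hv
    have h2 := inner_self_unitVec (z i) (hpos i)
    rw [real_inner_self_eq_norm_sq] at h2
    nlinarith [norm_nonneg (unitVec (z i))]
  · intro v hv w hw hvw
    obtain ⟨i, -, rfl⟩ := Finset.mem_image.1 hv
    obtain ⟨j, -, rfl⟩ := Finset.mem_image.1 hw
    exact key i j fun h => hvw (by rw [h])

/-! ### Sums of signs -/

/-- The sign attached to a bit. -/
def sgn (b : Bool) : ℤ := cond b (-1) 1

lemma sgn_or (b : Bool) : sgn b = 1 ∨ sgn b = -1 := by cases b <;> simp [sgn]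

lemma sgn_xor (a b : Bool) : sgn (a ^^ b) = sgn a * sgn b := by
  cases a <;> cases b <;> simp [sgn]

lemma prod_or {α : Type*} [DecidableEq α] (s : Finset α) (z : α → ℤ)
    (hz : ∀ i ∈ s, z i = 1 ∨ z i = -1) : ∏ i ∈ s, z i = 1 ∨ ∏ i ∈ s, z i = -1 := by
  induction s using Finset.induction_on with
  | empty => simp
  | insert a s ha ih =>
    rw [Finset.prod_insert ha]
    rcases ih fun i hi => hz i (Finset.mem_insert_of_mem hi) with h | h <;>
    rcases hz a (Finset.mem_insert_self _ _) with h' | h' <;> simp [h, h']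

/-- A family of signs with product `-1` has at least one minus sign, and a nontrivial family
with product `1` has at least two. -/
lemma sum_sign {α : Type*} [DecidableEq α] (s : Finset α) (z : α → ℤ)
    (hz : ∀ i ∈ s, z i = 1 ∨ z i = -1) :
    (∏ i ∈ s, z i = -1 → ∑ i ∈ s, z i ≤ s.card - 2) ∧
    (∏ i ∈ s, z i = 1 → (∀ i ∈ s, z i = 1) ∨ ∑ i ∈ s, z i ≤ s.card - 4) ∧
    ∑ i ∈ s, z i ≤ s.card := by
  induction s using Finset.induction_on with
  | empty => simp
  | insert a s ha ih =>
    obtain ⟨h1, h2, h3⟩ := ih fun i hi => hz i (Finset.mem_insert_of_mem hi)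
    rw [Finset.prod_insert ha, Finset.sum_insert ha, Finset.card_insert_of_notMem ha]
    push_cast
    rcases hz a (Finset.mem_insert_self _ _) with h' | h' <;> rw [h']
    · refine ⟨fun h => ?_, fun h => ?_, by linarith⟩
      · have := h1 (by linarith)
        linarith
      · rcases h2 (by linarith) with h | h
        · left
          intro i hi
          rcases Finset.mem_insert.1 hi with rfl | hi
          · exact h'
          · exact h i hi
        · right
          linarith
    · refine ⟨fun h => by linarith, fun h => ?_, by linarith⟩
      have := h1 (by linarith)
      right
      linarith

/-! ### The codes -/

/-- The coordinates at which the bits of `n` are set. -/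
def supp (n : ℕ) : Finset (Fin 19) := Finset.univ.filter fun i => n.testBit i

/-- Number of bits set among the lowest 19. -/
def pc (n : ℕ) : ℕ :=
    (n.testBit 0).toNat + (n.testBit 1).toNat + (n.testBit 2).toNat + (n.testBit 3).toNat +
    (n.testBit 4).toNat + (n.testBit 5).toNat + (n.testBit 6).toNat + (n.testBit 7).toNat +
    (n.testBit 8).toNat + (n.testBit 9).toNat + (n.testBit 10).toNat + (n.testBit 11).toNat +
    (n.testBit 12).toNat + (n.testBit 13).toNat + (n.testBit 14).toNat + (n.testBit 15).toNat +
    (n.testBit 16).toNat + (n.testBit 17).toNat + (n.testBit 18).toNat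

lemma card_supp (n : ℕ) : (supp n).card = pc n := by
  have h : ∀ i : Fin 19, (if n.testBit i = true then 1 else 0) = (n.testBit i).toNat := by
    intro i
    cases n.testBit i <;> rfl
  rw [supp, Finset.card_filter, Finset.sum_congr rfl fun i _ => h i,
    Fin.sum_univ_eq_sum_range fun i => (n.testBit i).toNat]
  simp only [Finset.sum_range_succ, Finset.sum_range_zero, zero_add, pc, add_assoc]

lemma supp_inter (m n : ℕ) : supp m ∩ supp n = supp (m &&& n) := by
  ext i
  simp [supp]

lemma mem_supp (n : ℕ) (i : Fin 19) : i ∈ supp n ↔ n.testBit i = true := by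
  simp [supp]

/-- The 78 octads of the binary Golay code that avoid five given points. -/
def octs : List ℕ := [
    7973, 8559, 15946, 17118, 25521, 31892, 34236, 39577, 42195, 51042, 55367, 58893, 63784,
    68472, 70749, 76311, 79154, 84390, 87683, 92361, 102084, 102881, 110734, 117786, 127568,
    133589, 136944, 141498, 150283, 152622, 158308, 161089, 167017, 168780, 175366, 176675,
    184722, 197293, 204168, 205762, 213107, 221468, 231185, 235572, 255136, 265359, 267178,
    273888, 275141, 282193, 282996, 290843, 297267, 300566, 305244, 316616, 322178, 334034,
    337560, 345385, 350732, 353350, 361035, 369444, 375809, 376981, 394586, 402485, 408336,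
    411524, 415905, 426214, 434569, 442936, 462370, 463111, 471144, 510272]

/-- Generators of a binary linear code of length 19, dimension 10 and minimal distance 5,
orthogonal to all octads. -/
def gens : Fin 10 → ℕ := ![696, 1393, 2139, 4279, 8559, 16486, 32973, 65947, 131470, 262565]

/-- The last coordinate of an octad. -/
def top (n : ℕ) : Fin 19 := Fin.ofNat 19 n.log2

lemma octs_card : octs.toFinset.card = 78 := by decide +kernel

lemma octs_basic : ∀ o ∈ octs, pc o = 8 ∧ o.testBit (top o) = true := by decide +kernel

lemma octs_inter : ∀ o ∈ octs, ∀ o' ∈ octs, o ≠ o' → pc (o &&& o') ≤ 4 := by decide +kernel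

lemma gens_octs : ∀ o ∈ octs, ∀ j, pc (o &&& gens j) % 2 = 0 := by decide +kernel

/-- Codeword with given coefficients. -/
def enc (a0 a1 a2 a3 a4 a5 a6 a7 a8 a9 : Bool) : ℕ :=
    cond a0 696 0 ^^^ cond a1 1393 0 ^^^ cond a2 2139 0 ^^^ cond a3 4279 0 ^^^ cond a4 8559 0
    ^^^ cond a5 16486 0 ^^^ cond a6 32973 0 ^^^ cond a7 65947 0 ^^^ cond a8 131470 0 ^^^ cond a9 262565 0

lemma enc_weight : ∀ a0 a1 a2 a3 a4 a5 a6 a7 a8 a9 : Bool,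
    (a0 || a1 || a2 || a3 || a4 || a5 || a6 || a7 || a8 || a9) = true →
    5 ≤ pc (enc a0 a1 a2 a3 a4 a5 a6 a7 a8 a9) := by
  decide +kernel

/-- Signs of the codeword with coefficients `m`. -/
def chi (m : Fin 10 → Bool) (i : Fin 19) : ℤ := ∏ j, sgn (m j && (gens j).testBit i)

lemma chi_or (m : Fin 10 → Bool) (i : Fin 19) : chi m i = 1 ∨ chi m i = -1 :=
  prod_or _ _ fun _ _ => sgn_or _

lemma chi_mul (m m' : Fin 10 → Bool) (i : Fin 19) :
    chi m i * chi m' i = chi (fun j => m j ^^ m' j) i := by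
  rw [chi, chi, chi, ← Finset.prod_mul_distrib]
  refine Finset.prod_congr rfl fun j _ => ?_
  rw [← sgn_xor]
  congr 1
  cases m j <;> cases m' j <;> simp

lemma chi_enc (m : Fin 10 → Bool) (i : Fin 19) :
    chi m i = sgn ((enc (m 0) (m 1) (m 2) (m 3) (m 4) (m 5) (m 6) (m 7) (m 8) (m 9)).testBit i) := by
  have h : ∀ (a : Bool) (g : ℕ) (i : ℕ), (cond a g 0).testBit i = (a && g.testBit i) := by
    intro a g i
    cases a <;> simp
  simp only [enc, Nat.testBit_xor, sgn_xor, h]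
  simp only [chi, Fin.prod_univ_succ, gens]
  simp [Fin.succ, mul_assoc]

lemma sum_sgn (n : ℕ) : ∑ i : Fin 19, sgn (n.testBit i) = 19 - 2 * (pc n : ℤ) := by
  have h : ∀ i : Fin 19, sgn (n.testBit i) = 1 - 2 * (if n.testBit i = true then 1 else 0) := by
    intro i
    cases n.testBit i <;> simp [sgn]
  rw [← card_supp, supp, Finset.card_filter, Finset.sum_congr rfl fun i _ => h i]
  rw [Finset.sum_sub_distrib, ← Finset.mul_sum]
  simp

lemma chi_sum (m : Fin 10 → Bool) (hm : ∃ j, m j = true) : ∑ i, chi m i ≤ 9 := by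
  have h := enc_weight (m 0) (m 1) (m 2) (m 3) (m 4) (m 5) (m 6) (m 7) (m 8) (m 9) (by
    obtain ⟨j, hj⟩ := hm
    fin_cases j <;> simp at hj <;> simp [hj])
  rw [Finset.sum_congr rfl fun i _ => chi_enc m i, sum_sgn]
  omega

lemma chi_prod (m : Fin 10 → Bool) (o : ℕ) (ho : o ∈ octs) : ∏ i ∈ supp o, chi m i = 1 := by
  simp only [chi]
  rw [Finset.prod_comm]
  refine Finset.prod_eq_one fun j _ => ?_
  cases m j
  · simp [sgn]
  · have h := gens_octs o ho j
    rw [← card_supp, ← supp_inter] at h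
    simp only [Bool.true_and, sgn, Bool.cond_eq_ite]
    rw [Finset.prod_ite, Finset.prod_const, Finset.prod_const_one, mul_one]
    have : (supp o).filter (fun i : Fin 19 => (gens j).testBit i = true) = supp o ∩ supp (gens j) := by
      ext i
      simp [mem_supp]
    rw [this]
    exact (Nat.even_iff.2 h).neg_one_pow

/-! ### Vectors of octad type -/

/-- Signs on an octad: free on all coordinates but the last one, total product `-1`. -/
def osgn (o : ℕ) (S : Finset (Fin 19)) (i : Fin 19) : ℤ :=
  if i = top o then - ∏ j ∈ (supp o).erase (top o), sgn (decide (j ∈ S))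
  else sgn (decide (i ∈ S))

lemma osgn_or (o : ℕ) (S : Finset (Fin 19)) (i : Fin 19) : osgn o S i = 1 ∨ osgn o S i = -1 := by
  unfold osgn
  split_ifs
  · rcases prod_or ((supp o).erase (top o)) (fun j => sgn (decide (j ∈ S)))
      (fun _ _ => sgn_or _) with h | h <;> simp [h]
  · exact sgn_or _

lemma osgn_prod (o : ℕ) (ho : o ∈ octs) (S : Finset (Fin 19)) :
    ∏ i ∈ supp o, osgn o S i = -1 := by
  have ht : top o ∈ supp o := (mem_supp _ _).2 (octs_basic o ho).2
  rw [← Finset.mul_prod_erase _ _ ht]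
  have h : ∏ i ∈ (supp o).erase (top o), osgn o S i =
      ∏ j ∈ (supp o).erase (top o), sgn (decide (j ∈ S)) := by
    refine Finset.prod_congr rfl fun i hi => ?_
    rw [osgn, if_neg (Finset.ne_of_mem_erase hi)]
  rw [h, osgn, if_pos rfl]
  rcases prod_or ((supp o).erase (top o)) (fun j => sgn (decide (j ∈ S)))
      (fun _ _ => sgn_or _) with h | h <;> simp [h]

/-- The vectors `(±2^8, 0^11)`. -/
def ovec (o : ℕ) (S : Finset (Fin 19)) (i : Fin 19) : ℤ :=
  if i ∈ supp o then 2 * osgn o S i else 0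

lemma dot_ovec_left (o : ℕ) (S : Finset (Fin 19)) (y : Fin 19 → ℤ) :
    dot (ovec o S) y = 2 * ∑ i ∈ supp o, osgn o S i * y i := by
  simp only [dot, ovec, ite_mul, zero_mul]
  rw [← Finset.sum_filter, Finset.filter_mem_eq_inter, Finset.univ_inter, Finset.mul_sum]
  simp only [mul_assoc]

lemma dot_ovec (o o' : ℕ) (S S' : Finset (Fin 19)) :
    dot (ovec o S) (ovec o' S') =
      4 * ∑ i ∈ supp o ∩ supp o', osgn o S i * osgn o' S' i := by
  rw [dot_ovec_left]
  simp only [ovec, mul_ite, mul_zero]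
  rw [← Finset.sum_filter, Finset.filter_mem_eq_inter, Finset.mul_sum, Finset.mul_sum]
  refine Finset.sum_congr rfl fun i _ => by ring

lemma mul_or {a b : ℤ} (ha : a = 1 ∨ a = -1) (hb : b = 1 ∨ b = -1) :
    a * b = 1 ∨ a * b = -1 := by
  rcases ha with rfl | rfl <;> rcases hb with rfl | rfl <;> simp

lemma mul_self_of_or {a : ℤ} (ha : a = 1 ∨ a = -1) : a * a = 1 := by
  rcases ha with rfl | rfl <;> simp

lemma dot_ovec_self (o : ℕ) (ho : o ∈ octs) (S : Finset (Fin 19)) :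
    dot (ovec o S) (ovec o S) = 32 := by
  rw [dot_ovec, Finset.inter_self,
    Finset.sum_congr rfl fun i _ => mul_self_of_or (osgn_or o S i)]
  simp [card_supp, (octs_basic o ho).1]

lemma dot_ovec_ne (o o' : ℕ) (ho : o ∈ octs) (ho' : o' ∈ octs) (h : o ≠ o')
    (S S' : Finset (Fin 19)) : dot (ovec o S) (ovec o' S') ≤ 16 := by
  rw [dot_ovec]
  have h1 := (sum_sign (supp o ∩ supp o') (fun i => osgn o S i * osgn o' S' i)
    fun i _ => mul_or (osgn_or _ _ _) (osgn_or _ _ _)).2.2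
  have h2 := octs_inter o ho o' ho' h
  rw [← card_supp, ← supp_inter] at h2
  have h3 : ((supp o ∩ supp o').card : ℤ) ≤ 4 := by exact_mod_cast h2
  linarith

lemma dot_ovec_eq (o : ℕ) (ho : o ∈ octs) (S S' : Finset (Fin 19))
    (hS : S ⊆ (supp o).erase (top o)) (hS' : S' ⊆ (supp o).erase (top o)) (h : S ≠ S') :
    dot (ovec o S) (ovec o S') ≤ 16 := by
  rw [dot_ovec, Finset.inter_self]
  have h1 := (sum_sign (supp o) (fun i => osgn o S i * osgn o S' i)
    fun i _ => mul_or (osgn_or _ _ _) (osgn_or _ _ _)).2.1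
  rw [Finset.prod_mul_distrib, osgn_prod o ho, osgn_prod o ho, card_supp,
    (octs_basic o ho).1] at h1
  rcases h1 (by norm_num) with h1 | h1
  · exfalso
    apply h
    have key : ∀ i ∈ (supp o).erase (top o), (i ∈ S ↔ i ∈ S') := by
      intro i hi
      have h2 := h1 i (Finset.mem_of_mem_erase hi)
      simp only [osgn, if_neg (Finset.ne_of_mem_erase hi)] at h2
      by_cases hA : i ∈ S <;> by_cases hB : i ∈ S' <;> simp [hA, hB, sgn] at h2 ⊢
    ext i
    constructor
    · intro hi
      exact (key i (hS hi)).1 hi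
    · intro hi
      exact (key i (hS' hi)).2 hi
  · push_cast at h1
    linarith

lemma dot_ovec_chi (o : ℕ) (ho : o ∈ octs) (S : Finset (Fin 19)) (m : Fin 10 → Bool) :
    dot (ovec o S) (chi m) ≤ 12 := by
  rw [dot_ovec_left]
  have h1 := (sum_sign (supp o) (fun i => osgn o S i * chi m i)
    fun i _ => mul_or (osgn_or _ _ _) (chi_or _ _)).1
  rw [Finset.prod_mul_distrib, osgn_prod o ho, chi_prod m o ho, card_supp,
    (octs_basic o ho).1] at h1
  have := h1 (by norm_num)
  push_cast at this
  linarith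

/-! ### Vectors with two nonzero coordinates -/

/-- The vectors `(±4^2, 0^17)`. -/
def pvec (i j : Fin 19) (a b : Bool) (k : Fin 19) : ℤ :=
  (if k = i then 4 * sgn a else 0) + (if k = j then 4 * sgn b else 0)

lemma dot_pvec (i j : Fin 19) (a b : Bool) (y : Fin 19 → ℤ) :
    dot (pvec i j a b) y = 4 * (sgn a * y i + sgn b * y j) := by
  simp only [dot, pvec, add_mul, Finset.sum_add_distrib, ite_mul, zero_mul, Finset.sum_ite_eq',
    Finset.mem_univ, if_true]
  ring

lemma dot_pvec_le (i j : Fin 19) (a b : Bool) (y : Fin 19 → ℤ) (c : ℤ)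
    (hy : ∀ i, y i ≤ c ∧ -y i ≤ c) : dot (pvec i j a b) y ≤ 8 * c := by
  rw [dot_pvec]
  have h1 := hy i
  have h2 := hy j
  rcases sgn_or a with h | h <;> rcases sgn_or b with h' | h' <;> rw [h, h'] <;> linarith

lemma dot_pvec_self (i j : Fin 19) (hij : i < j) (a b : Bool) :
    dot (pvec i j a b) (pvec i j a b) = 32 := by
  rw [dot_pvec]
  simp only [pvec, if_neg hij.ne, if_neg hij.ne', if_true]
  rcases sgn_or a with h | h <;> rcases sgn_or b with h' | h' <;> rw [h, h'] <;> norm_num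

lemma dot_pvec_ne (i j i' j' : Fin 19) (hij : i < j) (hij' : i' < j') (a b a' b' : Bool)
    (h : ¬ (i = i' ∧ j = j' ∧ a = a' ∧ b = b')) :
    dot (pvec i j a b) (pvec i' j' a' b') ≤ 16 := by
  rw [dot_pvec]
  simp only [pvec]
  by_cases h1 : i = i'
  · subst h1
    by_cases h2 : j = j'
    · subst h2
      simp only [if_neg hij.ne, if_neg hij.ne', if_true]
      cases a <;> cases b <;> cases a' <;> cases b' <;> simp [sgn] at h ⊢
    · simp only [if_neg hij'.ne, if_neg hij.ne', if_neg h2, if_true]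
      cases a <;> cases b <;> cases a' <;> cases b' <;> simp [sgn]
  · by_cases h2 : j = j'
    · subst h2
      simp only [if_neg hij.ne, if_neg hij'.ne', if_neg h1, if_true]
      cases a <;> cases b <;> cases a' <;> cases b' <;> simp [sgn]
    · simp only [if_neg h1, if_neg h2]
      by_cases h3 : i = j'
      · have h4 : j ≠ i' := by
          rintro rfl
          subst h3
          exact absurd hij hij'.asymm
        simp only [if_neg h4, h3, if_true]
        cases a <;> cases b <;> cases a' <;> cases b' <;> simp [sgn]
      · simp only [if_neg h3]
        split_ifs <;> cases a <;> cases b <;> cases a' <;> cases b' <;> simp [sgn]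

/-! ### Vectors with all coordinates nonzero -/

lemma dot_chi_self (m : Fin 10 → Bool) : dot (chi m) (chi m) = 19 := by
  rw [dot, Finset.sum_congr rfl fun i _ => mul_self_of_or (chi_or m i)]
  simp

lemma dot_chi_ne (m m' : Fin 10 → Bool) (h : m ≠ m') : dot (chi m) (chi m') ≤ 9 := by
  rw [dot, Finset.sum_congr rfl fun i _ => chi_mul m m' i]
  apply chi_sum
  obtain ⟨j, hj⟩ := Function.ne_iff.1 h
  exact ⟨j, by simpa using hj⟩

/-! ### Assembly -/

lemma dot_comm (x y : Fin 19 → ℤ) : dot x y = dot y x := by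
  simp only [dot, mul_comm]

/-- Indices of the vectors `(±4^2, 0^17)`. -/
abbrev PairIdx : Type := {p : Fin 19 × Fin 19 // p.1 < p.2} × Bool × Bool

/-- Indices of the vectors `(±2^8, 0^11)`. -/
abbrev OctIdx : Type :=
  Σ o : {o : ℕ // o ∈ octs.toFinset}, {S // S ∈ ((supp o.1).erase (top o.1)).powerset}

/-- Indices of all vectors. -/
abbrev Idx : Type := PairIdx ⊕ OctIdx ⊕ (Fin 10 → Bool)

/-- The configuration, up to scaling. -/
def vec : Idx → Fin 19 → ℤ
  | .inl p => pvec p.1.1.1 p.1.1.2 p.2.1 p.2.2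
  | .inr (.inl q) => ovec q.1.1 q.2.1
  | .inr (.inr m) => chi m

lemma card_pairs : Fintype.card {p : Fin 19 × Fin 19 // p.1 < p.2} = 171 := by
  rw [Fintype.card_subtype]
  decide +kernel

lemma card_octIdx : Fintype.card OctIdx = 9984 := by
  rw [Fintype.card_sigma]
  have h : ∀ o : {o : ℕ // o ∈ octs.toFinset},
      Fintype.card {S // S ∈ ((supp o.1).erase (top o.1)).powerset} = 128 := by
    rintro ⟨o, ho⟩
    have ho' : o ∈ octs := List.mem_toFinset.1 ho
    have ht : top o ∈ supp o := (mem_supp _ _).2 (octs_basic o ho').2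
    rw [Fintype.card_coe, Finset.card_powerset, Finset.card_erase_of_mem ht, card_supp,
      (octs_basic o ho').1]
    norm_num
  rw [Finset.sum_congr rfl fun o _ => h o, Finset.sum_const, Finset.card_univ, Fintype.card_coe,
    octs_card]
  norm_num

lemma card_idx : Fintype.card Idx = 11692 := by
  rw [Fintype.card_sum, Fintype.card_sum, card_octIdx, Fintype.card_prod, card_pairs]
  simp

lemma ovec_bound (o : ℕ) (S : Finset (Fin 19)) (i : Fin 19) :
    ovec o S i ≤ 2 ∧ -ovec o S i ≤ 2 := by
  unfold ovec
  split_ifs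
  · rcases osgn_or o S i with h | h <;> rw [h] <;> norm_num
  · norm_num

lemma chi_bound (m : Fin 10 → Bool) (i : Fin 19) : chi m i ≤ 1 ∧ -chi m i ≤ 1 := by
  rcases chi_or m i with h | h <;> rw [h] <;> norm_num

lemma self_pair (p : PairIdx) : dot (vec (.inl p)) (vec (.inl p)) = 32 :=
  dot_pvec_self _ _ p.1.2 _ _

lemma self_oct (q : OctIdx) : dot (vec (.inr (.inl q))) (vec (.inr (.inl q))) = 32 :=
  dot_ovec_self _ (List.mem_toFinset.1 q.1.2) _

lemma self_chi (m : Fin 10 → Bool) : dot (vec (.inr (.inr m))) (vec (.inr (.inr m))) = 19 :=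
  dot_chi_self _

lemma pair_oct (p : PairIdx) (q : OctIdx) :
    dot (vec (.inl p)) (vec (.inr (.inl q))) ≤ 16 :=
  dot_pvec_le _ _ _ _ _ 2 fun i => ovec_bound _ _ i

lemma pair_chi (p : PairIdx) (m : Fin 10 → Bool) :
    dot (vec (.inl p)) (vec (.inr (.inr m))) ≤ 8 :=
  dot_pvec_le _ _ _ _ _ 1 fun i => chi_bound _ i

lemma oct_chi (q : OctIdx) (m : Fin 10 → Bool) :
    dot (vec (.inr (.inl q))) (vec (.inr (.inr m))) ≤ 12 :=
  dot_ovec_chi _ (List.mem_toFinset.1 q.1.2) _ _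

lemma pair_pair (p p' : PairIdx) (h : p ≠ p') :
    dot (vec (.inl p)) (vec (.inl p')) ≤ 16 := by
  obtain ⟨⟨⟨i, j⟩, hij⟩, a, b⟩ := p
  obtain ⟨⟨⟨i', j'⟩, hij'⟩, a', b'⟩ := p'
  refine dot_pvec_ne i j i' j' hij hij' a b a' b' ?_
  rintro ⟨rfl, rfl, rfl, rfl⟩
  exact h rfl

lemma oct_oct (q q' : OctIdx) (h : q ≠ q') :
    dot (vec (.inr (.inl q))) (vec (.inr (.inl q'))) ≤ 16 := by
  obtain ⟨⟨o, ho⟩, S, hS⟩ := q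
  obtain ⟨⟨o', ho'⟩, S', hS'⟩ := q'
  by_cases hoo : o = o'
  · subst hoo
    refine dot_ovec_eq o (List.mem_toFinset.1 ho) S S' (Finset.mem_powerset.1 hS)
      (Finset.mem_powerset.1 hS') ?_
    rintro rfl
    exact h rfl
  · exact dot_ovec_ne o o' (List.mem_toFinset.1 ho) (List.mem_toFinset.1 ho') hoo S S'

lemma vec_pos (i : Idx) : 0 < dot (vec i) (vec i) := by
  rcases i with p | q | m
  · rw [self_pair]; norm_num
  · rw [self_oct]; norm_num
  · rw [self_chi]; norm_num

lemma vec_ne (i j : Idx) (h : i ≠ j) : ∃ b : ℤ, 0 ≤ b ∧ dot (vec i) (vec j) ≤ b ∧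
    4 * b ^ 2 ≤ dot (vec i) (vec i) * dot (vec j) (vec j) := by
  rcases i with p | q | m <;> rcases j with p' | q' | m' <;>
    simp only [self_pair, self_oct, self_chi]
  · exact ⟨16, by norm_num, pair_pair p p' fun e => h (by rw [e]), by norm_num⟩
  · exact ⟨16, by norm_num, pair_oct p q', by norm_num⟩
  · exact ⟨8, by norm_num, pair_chi p m', by norm_num⟩
  · exact ⟨16, by norm_num, dot_comm _ _ ▸ pair_oct p' q, by norm_num⟩
  · exact ⟨16, by norm_num, oct_oct q q' fun e => h (by rw [e]), by norm_num⟩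
  · exact ⟨12, by norm_num, oct_chi q m', by norm_num⟩
  · exact ⟨8, by norm_num, dot_comm _ _ ▸ pair_chi p' m, by norm_num⟩
  · exact ⟨12, by norm_num, dot_comm _ _ ▸ oct_chi q' m, by norm_num⟩
  · exact ⟨9, by norm_num, dot_chi_ne m m' fun e => h (by rw [e]), by norm_num⟩

end Kissing19

/-- The kissing number in 19 dimensions is at least 11692: there is a set of 11692 unit
vectors in Euclidean space ℝ^19 whose pairwise inner products are at most 1/2. -/
theorem kissing_dim19_ge_11692 :
    ∃ V : Finset (EuclideanSpace ℝ (Fin 19)),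
      V.card = 11692 ∧
      (∀ v ∈ V, ‖v‖ = 1) ∧
      (∀ v ∈ V, ∀ w ∈ V, v ≠ w → ⟪v, w⟫ ≤ (1 : ℝ) / 2) :=
  Kissing19.main_of_family Kissing19.card_idx Kissing19.vec Kissing19.vec_pos Kissing19.vec_ne
end

section
/- There exist finite sets C, D ⊆ 𝔽₂^19 such that: every element of C has Hamming weight exactly 8; any two distinct elements of C have Hamming distance at least 8; |C| = 78; any two distinct elements of D have Hamming distance at least 5; |D| = 1024; and every d ∈ D satisfies Σᵢ dᵢcᵢ = 0 in 𝔽₂ for every c ∈ C. -/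
/-- The vector in `𝔽₂^19` given by the binary digits of `a`. -/
def gvec (a : ℕ) : Fin 19 → ZMod 2 := fun i => bif a.testBit i then 1 else 0

/-- Number of ones among the first `n` binary digits. -/
def gcnt : ℕ → ℕ → ℕ
  | 0, _ => 0
  | n + 1, a => gcnt n a + (a.testBit n).toNat

/-- XOR-combination of the generators selected by the binary digits of `m` from place `i` on. -/
def genc : List ℕ → ℕ → ℕ → ℕ
  | [], _, _ => 0
  | g :: gs, i, m => (bif m.testBit i then g else 0) ^^^ genc gs (i + 1) m

def genD : List ℕ := [2787, 5574, 11148, 22296, 44592, 89184, 178368, 356736, 93952, 187904]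

def genC : List ℕ := [7973, 8559, 24059, 42195, 87683, 176675, 359267]

def wordsC : List ℕ := ((List.range 128).map (genc genC 0)).filter (fun a => gcnt 19 a == 8)

theorem genc_xor (gs : List ℕ) : ∀ i m n, genc gs i (m ^^^ n) = genc gs i m ^^^ genc gs i n := by
  induction gs with
  | nil => intro i m n; simp [genc]
  | cons g gs ih =>
    intro i m n
    simp only [genc, ih, Nat.testBit_xor]
    cases m.testBit i <;> cases n.testBit i <;>
      simp [Nat.xor_assoc, Nat.xor_left_comm]

theorem gvec_xor (a b : ℕ) : gvec (a ^^^ b) = gvec a - gvec b := by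
  funext i
  simp only [gvec, Nat.testBit_xor, Pi.sub_apply]
  cases a.testBit i <;> cases b.testBit i <;> decide

theorem gcnt_eq (n a : ℕ) : gcnt n a = ∑ i : Fin n, (a.testBit i).toNat := by
  induction n with
  | zero => simp [gcnt]
  | succ n ih => rw [Fin.sum_univ_castSucc, gcnt, ih]; simp

theorem norm_gvec (a : ℕ) : hammingNorm (gvec a) = gcnt 19 a := by
  rw [gcnt_eq, hammingNorm, Finset.card_filter]
  refine Finset.sum_congr rfl fun i _ => ?_
  by_cases h : a.testBit i = true <;> simp [gvec, h]

theorem dist_gvec (a b : ℕ) : hammingDist (gvec a) (gvec b) = gcnt 19 (a ^^^ b) := by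
  rw [hammingDist_comm, hammingDist_eq_hammingNorm, ← norm_gvec, gvec_xor]
  congr 1
  abel

theorem dot_gvec (a b : ℕ) : ∑ i, gvec a i * gvec b i = (gcnt 19 (a &&& b) : ZMod 2) := by
  rw [gcnt_eq, Nat.cast_sum]
  refine Finset.sum_congr rfl fun i _ => ?_
  simp only [gvec, Nat.testBit_and]
  cases a.testBit i <;> cases b.testBit i <;> simp

theorem dot_genc (c : Fin 19 → ZMod 2) (gs : List ℕ)
    (h : ∀ g ∈ gs, ∑ i, gvec g i * c i = 0) :
    ∀ i m, ∑ j, gvec (genc gs i m) j * c j = 0 := by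
  induction gs with
  | nil => intro i m; simp [genc, gvec]
  | cons g gs ih =>
    intro i m
    have h2 := ih (fun g hg => h g (List.mem_cons_of_mem _ hg)) (i + 1) m
    have h1 := h g List.mem_cons_self
    simp only [genc, gvec_xor, Pi.sub_apply, sub_mul, Finset.sum_sub_distrib, h2]
    cases m.testBit i
    · simp [gvec]
    · simp [h1]

theorem wordsD_wt : ∀ m ∈ List.range 1024, m ≠ 0 → 5 ≤ gcnt 19 (genc genD 0 m) := by
  decide +kernel

theorem wordsC_len : wordsC.length = 78 := by decide +kernel

theorem wordsC_dist : ∀ a ∈ wordsC, ∀ b ∈ wordsC, a ≠ b → 8 ≤ gcnt 19 (a ^^^ b) := by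
  decide +kernel

theorem wordsC_nodup : wordsC.Nodup := by decide +kernel

theorem wordsCD_dot : ∀ c ∈ wordsC, ∀ g ∈ genD, gcnt 19 (g &&& c) % 2 = 0 := by decide +kernel

theorem dist_genc (m n : ℕ) (hm : m < 1024) (hn : n < 1024) (h : m ≠ n) :
    5 ≤ hammingDist (gvec (genc genD 0 m)) (gvec (genc genD 0 n)) := by
  rw [dist_gvec, ← genc_xor]
  refine wordsD_wt _ (List.mem_range.2 ?_) ?_
  · exact Nat.xor_lt_two_pow (n := 10) hm hn
  · simpa [Nat.xor_eq_zero_iff] using h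


/-- There exist codes `C, D ⊆ 𝔽₂^19` such that every element of `C` has Hamming
weight exactly 8, distinct elements of `C` are at Hamming distance at least 8,
`|C| = 78`, distinct elements of `D` are at Hamming distance at least 5,
`|D| = 1024`, and every element of `D` is orthogonal (mod 2) to every element of `C`. -/
theorem exists_codes_dim19 :
    ∃ C D : Finset (Fin 19 → ZMod 2),
      (∀ c ∈ C, hammingNorm c = 8) ∧
      (∀ c ∈ C, ∀ c' ∈ C, c ≠ c' → 8 ≤ hammingDist c c') ∧
      C.card = 78 ∧
      (∀ d ∈ D, ∀ d' ∈ D, d ≠ d' → 5 ≤ hammingDist d d') ∧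
      D.card = 1024 ∧
      (∀ d ∈ D, ∀ c ∈ C, (∑ i : Fin 19, d i * c i) = 0) := by
  classical
  refine ⟨wordsC.toFinset.image gvec,
    (Finset.range 1024).image (fun m => gvec (genc genD 0 m)), ?_, ?_, ?_, ?_, ?_, ?_⟩
  · intro c hc
    obtain ⟨a, ha, rfl⟩ := Finset.mem_image.1 hc
    rw [norm_gvec]
    have := (List.mem_filter.1 (List.mem_toFinset.1 ha)).2
    simpa using this
  · intro c hc c' hc' hne
    obtain ⟨a, ha, rfl⟩ := Finset.mem_image.1 hc
    obtain ⟨b, hb, rfl⟩ := Finset.mem_image.1 hc'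
    rw [dist_gvec]
    exact wordsC_dist a (List.mem_toFinset.1 ha) b (List.mem_toFinset.1 hb)
      (fun h => hne (by rw [h]))
  · rw [Finset.card_image_of_injOn, List.toFinset_card_of_nodup wordsC_nodup, wordsC_len]
    intro a ha b hb hab
    by_contra hne
    have := wordsC_dist a (List.mem_toFinset.1 ha) b (List.mem_toFinset.1 hb) hne
    rw [← dist_gvec, hab, hammingDist_self] at this
    omega
  · intro d hd d' hd' hne
    obtain ⟨m, hm, rfl⟩ := Finset.mem_image.1 hd
    obtain ⟨n, hn, rfl⟩ := Finset.mem_image.1 hd'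
    exact dist_genc m n (Finset.mem_range.1 hm) (Finset.mem_range.1 hn)
      (fun h => hne (by rw [h]))
  · rw [Finset.card_image_of_injOn, Finset.card_range]
    intro m hm n hn hmn
    by_contra hne
    have := dist_genc m n (Finset.mem_range.1 hm) (Finset.mem_range.1 hn) hne
    simp only at hmn
    rw [hmn, hammingDist_self] at this
    omega
  · intro d hd c hc
    obtain ⟨m, hm, rfl⟩ := Finset.mem_image.1 hd
    obtain ⟨a, ha, rfl⟩ := Finset.mem_image.1 hc
    refine dot_genc _ _ (fun g hg => ?_) 0 m
    rw [dot_gvec]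
    exact (ZMod.natCast_eq_zero_iff _ _).2
      (Nat.dvd_of_mod_eq_zero (wordsCD_dot a (List.mem_toFinset.1 ha) g hg))
end
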